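/- Let σ ∈ {+1, −1} be fixed. For every ε > 0 there exists a constant η > 0 such that, for all sufficiently large primes p, the lower bound #{(n, m) : 1 ≤ n ≤ N, 1 ≤ m ≤ M, (nm|p) = σ} ≥ η·N·M holds with N = ⌊p^{1/(4√e) + ε}⌋ and an arbitrary positive integer M. -/

import Mathlib

open Polynomial in
/-- The operator `r ↦ f ^ k * (f ^ c * r)^{(k)} / f ^ c`, as a polynomial in `f` and `r`. -/
noncomputable def weightedDeriv {F : Type*} [CommRing F] (f : F[X]) (c : ℕ) : ℕ → (F[X] →ₗ[F] F[X])
  | 0 => LinearMap.id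
  | k + 1 => LinearMap.mulLeft F f ∘ₗ derivative ∘ₗ weightedDeriv f c k
      + LinearMap.mulLeft F (((c : F[X]) - (k : F[X])) * derivative f) ∘ₗ weightedDeriv f c k

section Stepanov

open Polynomial

theorem weightedDeriv_succ {F : Type*} [CommRing F] (f : F[X]) (c k : ℕ) (r : F[X]) :
    weightedDeriv f c (k + 1) r = f * derivative (weightedDeriv f c k r)
      + ((c : F[X]) - (k : F[X])) * derivative f * weightedDeriv f c k r := by
  simp [weightedDeriv, mul_assoc]

theorem pow_mul_iterate_derivative {F : Type*} [CommRing F] (f : F[X]) (c k : ℕ) (r : F[X]) :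
    f ^ k * derivative^[k] (f ^ c * r) = f ^ c * weightedDeriv f c k r := by
  induction k with
  | zero => simp [weightedDeriv]
  | succ k ih =>
    rw [Function.iterate_succ_apply', weightedDeriv_succ]
    have h := congrArg (fun q => f * derivative q) ih
    have key : ∀ n : ℕ, f * derivative (f ^ n) = (n : F[X]) * f ^ n * derivative f := by
      intro n
      rcases n with _ | n
      · simp
      · rw [derivative_pow_succ]; push_cast; simp; ring
    simp only [derivative_mul, mul_add] at h
    linear_combination h - (k : F[X]) * derivative f * ih - key k * derivative^[k] (f ^ c * r)
      + key c * weightedDeriv f c k r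

theorem degree_const_mul_le {F : Type*} [Field F] (a : F) (q : F[X]) :
    (C a * q).degree ≤ q.degree := by
  rw [← smul_eq_C_mul]
  exact degree_smul_le a q

theorem degree_mul_lt_add {F : Type*} [Field F] {a b : F[X]} {m n : ℕ} (ha : a.degree ≤ m)
    (hb : b.degree < n) : (a * b).degree < ((n + m : ℕ) : WithBot ℕ) := by
  by_cases hb0 : b = 0
  · subst hb0; simp
  by_cases ha0 : a = 0
  · subst ha0; simp
  rw [degree_eq_natDegree (mul_ne_zero ha0 hb0), natDegree_mul ha0 hb0]
  rw [degree_eq_natDegree ha0] at ha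
  rw [degree_eq_natDegree hb0] at hb
  norm_cast at *
  omega

theorem degree_weightedDeriv_lt {F : Type*} [Field F] (f : F[X]) (c k n : ℕ) {r : F[X]}
    (hr : r.degree < n) :
    (weightedDeriv f c k r).degree < ((n + k * f.natDegree : ℕ) : WithBot ℕ) := by
  induction k with
  | zero => simpa [weightedDeriv] using hr
  | succ k ih =>
    rw [weightedDeriv_succ]
    have e : n + (k + 1) * f.natDegree = (n + k * f.natDegree) + f.natDegree := by ring
    rw [e]
    refine lt_of_le_of_lt (degree_add_le _ _) (max_lt ?_ ?_)
    · exact degree_mul_lt_add degree_le_natDegree (lt_of_le_of_lt (degree_derivative_le) ih)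
    · refine degree_mul_lt_add ?_ ih
      have : ((c : F[X]) - (k : F[X])) * derivative f = C ((c : F) - k) * derivative f := by simp
      rw [this]
      exact (degree_const_mul_le _ _).trans (degree_derivative_le.trans degree_le_natDegree)

/-- The linear algebra step of Stepanov's method. -/
theorem exists_stepanov_coeffs {F : Type*} [Field F] (f : F[X]) (a : F) (h ℓ J n e : ℕ)
    (he : n + ℓ * f.natDegree + J ≤ e) (hdim : ℓ * e < J * (n + n)) :
    ∃ r s : ℕ → F[X], (∃ j < J, r j ≠ 0 ∨ s j ≠ 0) ∧
      (∀ j, (r j).degree < n) ∧ (∀ j, (s j).degree < n) ∧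
      ∀ k < ℓ, ∑ j ∈ Finset.range J,
        (weightedDeriv f ℓ k (r j) + C a * weightedDeriv f (ℓ + h) k (s j)) * X ^ j = 0 := by
  classical
  let D := degreeLT F n
  let φ : ℕ → ((Fin J → (D × D)) →ₗ[F] F[X]) := fun k =>
    ∑ j : Fin J, LinearMap.mulRight F (X ^ (j : ℕ)) ∘ₗ
      ((weightedDeriv f ℓ k) ∘ₗ D.subtype ∘ₗ LinearMap.fst F D D
        + a • ((weightedDeriv f (ℓ + h) k) ∘ₗ D.subtype ∘ₗ LinearMap.snd F D D))
      ∘ₗ LinearMap.proj j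
  have hφ : ∀ k v, φ k v = ∑ j : Fin J, (weightedDeriv f ℓ k (v j).1
      + C a * weightedDeriv f (ℓ + h) k (v j).2) * X ^ (j : ℕ) := by
    intro k v
    simp [φ, smul_eq_C_mul]
  have hmem : ∀ k : Fin ℓ, ∀ v, φ k v ∈ degreeLT F e := by
    intro k v
    rw [hφ]
    refine Submodule.sum_mem _ fun j _ => ?_
    rw [mem_degreeLT]
    have hlt : (weightedDeriv f ℓ k (v j).1
      + C a * weightedDeriv f (ℓ + h) k (v j).2).degree < ((n + k * f.natDegree : ℕ) : WithBot ℕ) := by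
      refine lt_of_le_of_lt (degree_add_le _ _) (max_lt ?_ ?_)
      · exact degree_weightedDeriv_lt _ _ _ _ (mem_degreeLT.1 (v j).1.2)
      · exact lt_of_le_of_lt (degree_const_mul_le _ _)
          (degree_weightedDeriv_lt _ _ _ _ (mem_degreeLT.1 (v j).2.2))
    rw [mul_comm]
    refine lt_of_lt_of_le (degree_mul_lt_add (m := j) (degree_X_pow_le _) hlt) ?_
    have h1 : (k : ℕ) * f.natDegree ≤ ℓ * f.natDegree := Nat.mul_le_mul_right _ k.2.le
    have h2 := j.2
    exact_mod_cast (by omega)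
  let Φ : (Fin J → (D × D)) →ₗ[F] (Fin ℓ → degreeLT F e) :=
    LinearMap.pi fun k => LinearMap.codRestrict _ (φ k) (hmem k)
  have fr : ∀ N : ℕ, Module.finrank F (degreeLT F N) = N := fun N => by
    rw [(degreeLTEquiv F N).finrank_eq]; simp
  have fd : ∀ N : ℕ, FiniteDimensional F (degreeLT F N) := fun N =>
    Module.Finite.equiv (degreeLTEquiv F N).symm
  have hker : LinearMap.ker Φ ≠ ⊥ := by
    have := fd n
    have := fd e
    apply LinearMap.ker_ne_bot_of_finrank_lt
    rw [Module.finrank_pi_fintype, Module.finrank_pi_fintype]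
    simp only [Module.finrank_prod, fr, D]
    simpa using hdim
  obtain ⟨v, hv, hv0⟩ := (Submodule.ne_bot_iff _).1 hker
  refine ⟨fun j => if hj : j < J then (v ⟨j, hj⟩).1 else 0,
    fun j => if hj : j < J then (v ⟨j, hj⟩).2 else 0, ?_, ?_, ?_, ?_⟩
  · by_contra hcon
    push Not at hcon
    apply hv0
    funext j
    have := hcon j j.2
    simp only [j.2, dif_pos] at this
    ext1
    · exact Subtype.ext this.1
    · exact Subtype.ext this.2
  · intro j
    dsimp only
    split_ifs with hj
    · exact mem_degreeLT.1 (v ⟨j, hj⟩).1.2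
    · simp
  · intro j
    dsimp only
    split_ifs with hj
    · exact mem_degreeLT.1 (v ⟨j, hj⟩).2.2
    · simp
  · intro k hk
    have h0 : φ k v = 0 := by
      have := congrFun (LinearMap.mem_ker.1 hv) ⟨k, hk⟩
      exact congrArg Subtype.val this
    rw [hφ] at h0
    rw [Finset.sum_range, ← h0]
    refine Finset.sum_congr rfl fun j _ => ?_
    simp

/-- Nonvanishing in Stepanov's method: one step. -/
theorem stepanov_eq_zero_of_X_pow_dvd {p : ℕ} [Fact p.Prime] (f : (ZMod p)[X]) (h n : ℕ)
    (hp : 2 * h + 1 = p) (β : ZMod p) (hβ : Odd (f.rootMultiplicity β)) (h0 : f.eval 0 ≠ 0)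
    (hn : 2 * n + f.natDegree ≤ p) {r s : (ZMod p)[X]} (hr : r.degree < n) (hs : s.degree < n)
    (hdvd : X ^ p ∣ r + s * f ^ h) : r = 0 ∧ s = 0 := by
  have hf : f ≠ 0 := by rintro rfl; simp at h0
  set c := f.eval 0 with hc
  have h1 : X ^ p ∣ f ^ p - C c := by
    have : f ^ p - C c = (f - C c) ^ p := by
      rw [sub_pow_char, ← C_pow, ZMod.pow_card]
    rw [this]
    exact pow_dvd_pow_of_dvd (by rw [X_dvd_iff, coeff_zero_eq_eval_zero]; simp [hc]) _
  have h2 : X ^ p ∣ r ^ 2 * f - C c * s ^ 2 := by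
    have e : r ^ 2 * f - C c * s ^ 2
        = (r + s * f ^ h) * ((r - s * f ^ h) * f) + s ^ 2 * (f ^ p - C c) := by
      have : f ^ p = f ^ (2 * h + 1) := by rw [hp]
      rw [this]; ring
    rw [e]
    exact dvd_add (hdvd.mul_right _) (h1.mul_left _)
  have hsq : ∀ {q : (ZMod p)[X]}, q.degree < n → (q ^ 2).degree < ((2 * n : ℕ) : WithBot ℕ) := by
    intro q hq
    by_cases hq0 : q = 0
    · subst hq0; rw [zero_pow two_ne_zero, degree_zero]; exact WithBot.bot_lt_coe _
    rw [degree_eq_natDegree hq0] at hq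
    rw [degree_eq_natDegree (pow_ne_zero _ hq0), natDegree_pow]
    norm_cast at *
    omega
  have h3 : r ^ 2 * f - C c * s ^ 2 = 0 := by
    by_contra hne
    have hle := degree_le_of_dvd h2 hne
    rw [degree_X_pow] at hle
    have hlt : (r ^ 2 * f - C c * s ^ 2).degree < ((2 * n + f.natDegree : ℕ) : WithBot ℕ) := by
      refine lt_of_le_of_lt (degree_sub_le _ _) (max_lt ?_ ?_)
      · rw [mul_comm]; exact degree_mul_lt_add degree_le_natDegree (hsq hr)
      · refine lt_of_le_of_lt (degree_const_mul_le _ _) (lt_of_lt_of_le (hsq hs) ?_)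
        exact_mod_cast (by omega)
    have := lt_of_le_of_lt hle hlt
    norm_cast at this
    omega
  have h4 : r ^ 2 * f = C c * s ^ 2 := sub_eq_zero.1 h3
  have hcc : (C c : (ZMod p)[X]) ≠ 0 := by simpa using h0
  by_cases hr0 : r = 0
  · refine ⟨hr0, ?_⟩
    subst hr0
    have : C c * s ^ 2 = 0 := by rw [← h4]; simp
    simpa [hcc, h0] using this
  · exfalso
    have hs0 : s ≠ 0 := by
      rintro rfl
      have : r ^ 2 * f = 0 := by rw [h4]; simp
      simp [hr0, hf] at this
    have h5 := congrArg (rootMultiplicity β) h4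
    rw [rootMultiplicity_mul (mul_ne_zero (pow_ne_zero _ hr0) hf),
      rootMultiplicity_mul (mul_ne_zero hcc (pow_ne_zero _ hs0)), rootMultiplicity_C, zero_add,
      pow_two, pow_two, rootMultiplicity_mul (mul_ne_zero hr0 hr0),
      rootMultiplicity_mul (mul_ne_zero hs0 hs0)] at h5
    rcases hβ with ⟨k, hk⟩
    omega

theorem stepanov_coeffs_eq_zero {p : ℕ} [Fact p.Prime] (f : (ZMod p)[X]) (h n : ℕ)
    (hp : 2 * h + 1 = p) (β : ZMod p) (hβ : Odd (f.rootMultiplicity β)) (h0 : f.eval 0 ≠ 0)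
    (hn : 2 * n + f.natDegree ≤ p) (J : ℕ) (r s : ℕ → (ZMod p)[X]) (hr : ∀ j, (r j).degree < n)
    (hs : ∀ j, (s j).degree < n)
    (hsum : ∑ j ∈ Finset.range J, (r j + s j * f ^ h) * X ^ (p * j) = 0) :
    ∀ j < J, r j = 0 ∧ s j = 0 := by
  induction J generalizing r s with
  | zero => intro j hj; omega
  | succ J ih =>
    rw [Finset.sum_range_succ'] at hsum
    have e : ∑ j ∈ Finset.range J, (r (j + 1) + s (j + 1) * f ^ h) * X ^ (p * (j + 1))
        = X ^ p * ∑ j ∈ Finset.range J, (r (j + 1) + s (j + 1) * f ^ h) * X ^ (p * j) := by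
      rw [Finset.mul_sum]
      refine Finset.sum_congr rfl fun j _ => ?_
      rw [mul_add p j 1, pow_add]; ring
    rw [e] at hsum
    simp only [mul_zero, pow_zero, mul_one] at hsum
    have z := stepanov_eq_zero_of_X_pow_dvd f h n hp β hβ h0 hn (hr 0) (hs 0)
      (by rw [eq_neg_of_add_eq_zero_right hsum]; exact (dvd_mul_right _ _).neg_right)
    rw [z.1, z.2] at hsum
    have hXp : (X : (ZMod p)[X]) ^ p ≠ 0 := pow_ne_zero _ X_ne_zero
    have z' := ih (fun j => r (j + 1)) (fun j => s (j + 1)) (fun j => hr _) (fun j => hs _)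
      (by simpa [hXp] using hsum)
    intro j hj
    rcases j with _ | j
    · exact z
    · exact z' j (by omega)

end Stepanov

section Stepanov

open Polynomial

theorem iterate_derivative_mul_X_pow_char {p : ℕ} [Fact p.Prime] (q : (ZMod p)[X]) (j k : ℕ) :
    derivative^[k] (q * X ^ (p * j)) = derivative^[k] q * X ^ (p * j) := by
  induction k with
  | zero => rfl
  | succ k ih =>
    rw [Function.iterate_succ_apply', ih, derivative_mul, derivative_X_pow,
      Function.iterate_succ_apply']
    simp

theorem stepanov_card_mul_le {p : ℕ} [Fact p.Prime] (f : (ZMod p)[X]) (h ℓ J : ℕ)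
    (hp : 2 * h + 1 = p) (β : ZMod p) (hβ : Odd (f.rootMultiplicity β)) (h0 : f.eval 0 ≠ 0)
    (hm : f.natDegree ≤ h) (hℓ : ℓ + h ≤ p)
    (hdim : ℓ * ((h - f.natDegree) + ℓ * f.natDegree + J)
      < J * ((h - f.natDegree) + (h - f.natDegree))) (a : ZMod p) (S : Finset (ZMod p))
    (hS : ∀ x ∈ S, f.eval x ≠ 0 ∧ (f.eval x) ^ h = a) :
    S.card * ℓ ≤ (J + f.natDegree) * p := by
  have hf : f ≠ 0 := by rintro rfl; simp at h0
  have hppos : 0 < p := (Fact.out : p.Prime).pos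
  rcases Nat.eq_zero_or_pos ℓ with rfl | hℓpos
  · simp
  set m := f.natDegree with hmdef
  set n := h - m with hn
  obtain ⟨r, s, ⟨j₀, hj₀, hne⟩, hr, hs, hrel⟩ :=
    exists_stepanov_coeffs f a h ℓ J n (n + ℓ * m + J) le_rfl hdim
  set P : (ZMod p)[X] :=
    ∑ j ∈ Finset.range J, (f ^ ℓ * r j + f ^ (ℓ + h) * s j) * X ^ (p * j) with hP
  have hP0 : P ≠ 0 := by
    intro hzero
    have e : P = f ^ ℓ * ∑ j ∈ Finset.range J, (r j + s j * f ^ h) * X ^ (p * j) := by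
      rw [hP, Finset.mul_sum]
      refine Finset.sum_congr rfl fun j _ => ?_
      rw [pow_add]; ring
    rw [e] at hzero
    have hz := (mul_eq_zero.1 hzero).resolve_left (pow_ne_zero _ hf)
    have := stepanov_coeffs_eq_zero f h n hp β hβ h0 (by omega) J r s hr hs hz j₀ hj₀
    rcases hne with h1 | h1
    · exact h1 this.1
    · exact h1 this.2
  have hroot : ∀ x ∈ S, ∀ k < ℓ, (derivative^[k] P).IsRoot x := by
    intro x hx k hk
    obtain ⟨hx0, hxa⟩ := hS x hx
    have hder : derivative^[k] P = ∑ j ∈ Finset.range J, (derivative^[k] (f ^ ℓ * r j)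
        + derivative^[k] (f ^ (ℓ + h) * s j)) * X ^ (p * j) := by
      rw [hP, iterate_derivative_sum]
      refine Finset.sum_congr rfl fun j _ => ?_
      rw [iterate_derivative_mul_X_pow_char, iterate_map_add]
    have hmul : f ^ k * derivative^[k] P = ∑ j ∈ Finset.range J,
        (f ^ ℓ * weightedDeriv f ℓ k (r j) + f ^ (ℓ + h) * weightedDeriv f (ℓ + h) k (s j))
          * X ^ (p * j) := by
      rw [hder, Finset.mul_sum]
      refine Finset.sum_congr rfl fun j _ => ?_
      rw [← pow_mul_iterate_derivative, ← pow_mul_iterate_derivative]; ring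
    have hev := congrArg (eval x) hmul
    have hrel' := congrArg (eval x) (hrel k hk)
    simp only [eval_mul, eval_pow, eval_finsetSum, eval_add, eval_X, eval_C, eval_zero]
      at hev hrel'
    have : eval x f ^ k * eval x (derivative^[k] P) = 0 := by
      rw [hev, ← mul_zero (eval x f ^ ℓ), ← hrel', Finset.mul_sum]
      refine Finset.sum_congr rfl fun j _ => ?_
      rw [pow_mul x p j, ZMod.pow_card, pow_add, hxa]; ring
    exact (mul_eq_zero.1 this).resolve_left (pow_ne_zero _ hx0)
  have hmult : ∀ x ∈ S, ℓ ≤ P.rootMultiplicity x := by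
    intro x hx
    have hlt : ℓ - 1 < P.rootMultiplicity x := by
      refine lt_rootMultiplicity_of_isRoot_iterate_derivative_of_mem_nonZeroDivisors hP0
        (fun k hk => hroot x hx k (by omega)) ?_
      rw [mem_nonZeroDivisors_iff_ne_zero]
      intro hfac
      rw [ZMod.natCast_eq_zero_iff, (Fact.out : p.Prime).dvd_factorial] at hfac
      omega
    omega
  have hdeg : P.natDegree ≤ (J + m) * p := by
    refine natDegree_sum_le_of_forall_le _ _ fun j hj => ?_
    have hj' : j + 1 ≤ J := Finset.mem_range.1 hj
    have d1 : (r j).natDegree ≤ n := natDegree_le_of_degree_le (hr j).le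
    have d2 : (s j).natDegree ≤ n := natDegree_le_of_degree_le (hs j).le
    have d3 : ∀ c q, c ≤ p → q.natDegree ≤ n → (f ^ c * q).natDegree ≤ p * m + n := by
      intro c q hc hq
      refine natDegree_mul_le.trans (add_le_add (natDegree_pow_le.trans ?_) hq)
      exact Nat.mul_le_mul_right _ hc
    have d4 : (f ^ ℓ * r j + f ^ (ℓ + h) * s j).natDegree ≤ p * m + n :=
      natDegree_add_le_of_degree_le (d3 _ _ (by omega) d1) (d3 _ _ hℓ d2)
    refine natDegree_mul_le.trans ((add_le_add d4 (natDegree_X_pow_le _)).trans ?_)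
    have : p * (j + 1) ≤ p * J := Nat.mul_le_mul_left _ hj'
    have hnp : n ≤ p := by omega
    nlinarith
  calc S.card * ℓ = ∑ x ∈ S, ℓ := by simp
    _ ≤ ∑ x ∈ S, P.rootMultiplicity x := Finset.sum_le_sum hmult
    _ ≤ ∑ x : ZMod p, P.rootMultiplicity x :=
        Finset.sum_le_sum_of_subset (Finset.subset_univ _)
    _ = ∑ x : ZMod p, P.roots.count x := by simp [count_roots]
    _ = P.roots.card := Multiset.sum_count_eq_card (fun _ _ => Finset.mem_univ _)
    _ ≤ P.natDegree := card_roots' P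
    _ ≤ _ := hdeg

theorem stepanov_dim_lt {p m ℓ t J n : ℕ} (hm : 1 ≤ m) (hlarge : 100 * m ^ 2 ≤ p)
    (hℓ1 : ℓ * ℓ ≤ p) (hℓ10 : 10 ≤ ℓ) (ht : t = 4 * m + 4) (hJ1 : ℓ + 2 * t ≤ 2 * J)
    (hJ2 : 2 * J ≤ ℓ + 2 * t + 2) (e1 : 2 * n + 1 + 2 * m = p) :
    ℓ * (n + ℓ * m + J) < J * (n + n) := by
  have e2 : 2 * m + 1 ≤ 3 * m ^ 2 := by nlinarith
  have e3 : 97 * p ≤ 200 * n := by linarith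
  have e4 : 10 * ℓ ≤ p := (Nat.mul_le_mul_right _ hℓ10).trans hℓ1
  have e5 : ℓ * (ℓ * m) ≤ p * m := by
    rw [← mul_assoc]; exact Nat.mul_le_mul_right _ hℓ1
  have e6 : (ℓ + 2 * t) * n ≤ 2 * J * n := Nat.mul_le_mul_right _ hJ1
  have e7 : ℓ * (2 * J) ≤ ℓ * (ℓ + 2 * t + 2) := Nat.mul_le_mul_left _ hJ2
  have e8 : 10 * ℓ * (t + 1) ≤ p * (t + 1) := Nat.mul_le_mul_right _ e4
  have e9 : t * (97 * p) ≤ t * (200 * n) := Nat.mul_le_mul_left _ e3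
  have e10 : t * p = 4 * (m * p) + 4 * p := by rw [ht]; ring
  have e11 : 0 < p := by omega
  have e12 : 0 ≤ m * p := Nat.zero_le _
  linarith

/-- For `p` large compared with `deg f`, at most `p / 2 + O(√p)` points satisfy `f ^ h = a`. -/
theorem stepanov_card_le {p : ℕ} [Fact p.Prime] (f : (ZMod p)[X]) (h : ℕ)
    (hp : 2 * h + 1 = p) (β : ZMod p) (hβ : Odd (f.rootMultiplicity β)) (h0 : f.eval 0 ≠ 0)
    (hm : 1 ≤ f.natDegree) (hlarge : 100 * f.natDegree ^ 2 ≤ p) (a : ZMod p)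
    (S : Finset (ZMod p)) (hS : ∀ x ∈ S, f.eval x ≠ 0 ∧ (f.eval x) ^ h = a) :
    (S.card : ℝ) ≤ p / 2 + 30 * f.natDegree * √p := by
  set m := f.natDegree with hmdef
  set ℓ := Nat.sqrt p with hℓ
  have hℓ1 : ℓ * ℓ ≤ p := Nat.sqrt_le p
  have hℓ2 : p < (ℓ + 1) * (ℓ + 1) := Nat.lt_succ_sqrt p
  have hℓ10 : 10 ≤ ℓ := by
    rw [hℓ, Nat.le_sqrt]; nlinarith
  set t := 4 * m + 4 with ht
  set J := ℓ / 2 + 1 + t with hJ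
  have hJ1 : ℓ + 2 * t ≤ 2 * J := by omega
  have hJ2 : 2 * J ≤ ℓ + 2 * t + 2 := by omega
  have hmh : m ≤ h := by nlinarith
  have key : S.card * ℓ ≤ (J + m) * p := by
    refine stepanov_card_mul_le f h ℓ J hp β hβ h0 ?_ ?_ ?_ a S hS
    · exact hmh
    · have : 10 * ℓ ≤ ℓ * ℓ := Nat.mul_le_mul_right _ hℓ10
      omega
    · obtain ⟨n, hn⟩ : ∃ n, h = n + m := ⟨h - m, by omega⟩
      have : h - m = n := by omega
      rw [← hmdef, this]
      have e1 : 2 * n + 1 + 2 * m = p := by omega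
      exact stepanov_dim_lt hm hlarge hℓ1 hℓ10 ht hJ1 hJ2 e1
  have hℓR : (10 : ℝ) ≤ ℓ := by exact_mod_cast hℓ10
  have hs1 : √(p : ℝ) ≤ 2 * ℓ := by
    have : √(p : ℝ) ≤ ℓ + 1 := by
      rw [Real.sqrt_le_left (by positivity), sq]
      exact_mod_cast hℓ2.le
    linarith
  have hs2 : (p : ℝ) ≤ 2 * √p * ℓ := by
    have h1 := Real.mul_self_sqrt (Nat.cast_nonneg p : (0 : ℝ) ≤ p)
    nlinarith [Real.sqrt_nonneg (p : ℝ)]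
  have keyR : (S.card : ℝ) * ℓ ≤ (J + m) * p := by exact_mod_cast key
  have hJR : (2 : ℝ) * J ≤ ℓ + 2 * t + 2 := by exact_mod_cast hJ2
  have htR : (t : ℝ) = 4 * m + 4 := by rw [ht]; push_cast; ring
  have hmR : (1 : ℝ) ≤ m := by exact_mod_cast hm
  have h1 : (S.card : ℝ) * ℓ ≤ (p / 2 + 30 * m * √p) * ℓ := by
    have h2 : ((J : ℝ) + m) * p ≤ (ℓ / 2 + t + 1 + m) * p := by
      apply mul_le_mul_of_nonneg_right _ (Nat.cast_nonneg p)
      linarith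
    have h3 : ((t : ℝ) + 1 + m) * p ≤ (10 * m) * (2 * √p * ℓ) :=
      mul_le_mul (by linarith) hs2 (Nat.cast_nonneg p) (by linarith)
    have h4 : 0 ≤ (m : ℝ) * √p * ℓ := by positivity
    nlinarith
  exact le_of_mul_le_mul_right h1 (by linarith)

end Stepanov

section Stepanov

open Polynomial

theorem abs_sum_quadraticChar_eval_le {p : ℕ} [Fact p.Prime] (hp2 : p ≠ 2) (f : (ZMod p)[X])
    (β : ZMod p) (hβ : Odd (f.rootMultiplicity β)) (h0 : f.eval 0 ≠ 0)
    (hm : 1 ≤ f.natDegree) (hlarge : 100 * f.natDegree ^ 2 ≤ p) :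
    |((∑ x : ZMod p, quadraticChar (ZMod p) (f.eval x) : ℤ) : ℝ)| ≤ 100 * f.natDegree * √p := by
  classical
  have hf : f ≠ 0 := by rintro rfl; simp at h0
  have hodd : 2 * (p / 2) + 1 = p := by
    have := (Fact.out : p.Prime).eq_two_or_odd
    omega
  have hchar : ringChar (ZMod p) ≠ 2 := by rwa [ZMod.ringChar_zmod_n]
  set Z := Finset.univ.filter fun x => quadraticChar (ZMod p) (f.eval x) = 0 with hZ
  set A := Finset.univ.filter fun x => quadraticChar (ZMod p) (f.eval x) = 1 with hA
  set B := Finset.univ.filter fun x => quadraticChar (ZMod p) (f.eval x) = -1 with hB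
  have htri : ∀ y : ZMod p, quadraticChar (ZMod p) y = 0 ∨ quadraticChar (ZMod p) y = 1
      ∨ quadraticChar (ZMod p) y = -1 := fun y => quadraticChar_isQuadratic (ZMod p) y
  have hsum : (∑ x : ZMod p, quadraticChar (ZMod p) (f.eval x) : ℤ) = A.card - B.card := by
    rw [hA, hB, Finset.card_filter, Finset.card_filter]
    push_cast
    rw [← Finset.sum_sub_distrib]
    refine Finset.sum_congr rfl fun x _ => ?_
    rcases htri (f.eval x) with h | h | h <;> rw [h] <;> norm_num
  have htot : (p : ℤ) = A.card + B.card + Z.card := by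
    rw [hA, hB, hZ, Finset.card_filter, Finset.card_filter, Finset.card_filter]
    push_cast
    rw [← Finset.sum_add_distrib, ← Finset.sum_add_distrib]
    trans ∑ x : ZMod p, (1 : ℤ)
    · simp [ZMod.card]
    refine Finset.sum_congr rfl fun x _ => ?_
    rcases htri (f.eval x) with h | h | h <;> rw [h] <;> norm_num
  have hZc : Z.card ≤ f.natDegree := by
    calc Z.card ≤ f.roots.toFinset.card := by
          refine Finset.card_le_card fun x hx => ?_
          rw [hZ, Finset.mem_filter, quadraticChar_eq_zero_iff] at hx
          simpa [hf] using hx.2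
      _ ≤ f.roots.card := Multiset.toFinset_card_le _
      _ ≤ _ := card_roots' f
  have hle : ∀ σ : ℤ, σ ≠ 0 →
      ((Finset.univ.filter fun x => quadraticChar (ZMod p) (f.eval x) = σ).card : ℝ)
        ≤ p / 2 + 30 * f.natDegree * √p := by
    intro σ hσ
    refine stepanov_card_le f (p / 2) hodd β hβ h0 hm hlarge (σ : ZMod p) _ fun x hx => ?_
    rw [Finset.mem_filter] at hx
    refine ⟨fun h => hσ ?_, ?_⟩
    · rw [← hx.2, h]; simp
    · rw [← hx.2, quadraticChar_eq_pow_of_char_ne_two' hchar, ZMod.card]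
  have hA' := hle 1 one_ne_zero
  have hB' := hle (-1) (by norm_num)
  rw [hsum]
  have htotR : (p : ℝ) = A.card + B.card + Z.card := by exact_mod_cast htot
  have hZR : (Z.card : ℝ) ≤ f.natDegree := by exact_mod_cast hZc
  have hsq : 1 ≤ √(p : ℝ) := by
    rw [Real.one_le_sqrt]
    exact_mod_cast (Fact.out : p.Prime).one_lt.le
  have hmm : (f.natDegree : ℝ) ≤ f.natDegree * √p := le_mul_of_one_le_right (by positivity) hsq
  push_cast
  rw [abs_le]
  constructor <;> linarith

/-- The Weil bound for quadratic character sums of products of linear factors. -/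
theorem abs_sum_quadraticChar_prod_le {p : ℕ} [Fact p.Prime] (hp2 : p ≠ 2) {ι : Type*} [Fintype ι]
    (b : ι → ZMod p) (β : ZMod p) (hβ : Odd (Finset.univ.filter fun i => b i = β).card) :
    |((∑ x : ZMod p, quadraticChar (ZMod p) (∏ i, (x + b i)) : ℤ) : ℝ)|
      ≤ 100 * Fintype.card ι * √p := by
  classical
  have hpR : (0 : ℝ) ≤ p := Nat.cast_nonneg p
  have hm : 1 ≤ Fintype.card ι :=
    (Nat.one_le_iff_ne_zero.2 hβ.pos.ne').trans (Finset.card_le_univ _)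
  by_cases hlarge : 100 * Fintype.card ι ^ 2 ≤ p
  · obtain ⟨t, ht⟩ : ∃ t : ZMod p, ∀ i, t + b i ≠ 0 := by
      by_contra! hcon
      have : Fintype.card (ZMod p) ≤ Fintype.card ι := by
        choose g hg using hcon
        refine Fintype.card_le_of_injective g fun x y hxy => ?_
        have h1 := hg x
        rw [hxy, ← hg y] at h1
        exact add_right_cancel h1
      rw [ZMod.card] at this
      nlinarith
    set f : (ZMod p)[X] := ∏ i, (X - C (-(t + b i))) with hf
    have hev : ∀ x, f.eval x = ∏ i, (x + t + b i) := by
      intro x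
      rw [hf, eval_prod]
      refine Finset.prod_congr rfl fun i _ => ?_
      simp; ring
    have hdeg : f.natDegree = Fintype.card ι := by
      rw [hf, natDegree_finsetProd_X_sub_C_eq_card]; simp
    have hroots : f.roots = Finset.univ.val.map fun i => -(t + b i) := by
      rw [← roots_multiset_prod_X_sub_C (Finset.univ.val.map fun i => -(t + b i)), Multiset.map_map]
      rfl
    have hmult : f.rootMultiplicity (-(t + β)) = (Finset.univ.filter fun i => b i = β).card := by
      rw [← count_roots, hroots, Multiset.count_map, Finset.card_def, Finset.filter_val]
      congr 1
      refine Multiset.filter_congr fun i _ => ?_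
      rw [neg_inj, add_right_inj, eq_comm]
    have h := abs_sum_quadraticChar_eval_le hp2 f (-(t + β)) (by rwa [hmult])
      (by rw [hev]; exact Finset.prod_ne_zero_iff.2 fun i _ => by simpa using ht i)
      (by rwa [hdeg]) (by rwa [hdeg])
    rw [hdeg] at h
    convert h using 3
    rw [← Equiv.sum_comp (Equiv.addRight t)]
    simp [hev]
  · push Not at hlarge
    have h1 : |((∑ x : ZMod p, quadraticChar (ZMod p) (∏ i, (x + b i)) : ℤ) : ℝ)| ≤ p := by
      push_cast
      refine (Finset.abs_sum_le_sum_abs _ _).trans ?_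
      calc _ ≤ ∑ x : ZMod p, (1 : ℝ) := by
            refine Finset.sum_le_sum fun x _ => ?_
            rcases quadraticChar_isQuadratic (ZMod p) (∏ i, (x + b i)) with h | h | h <;> rw [h] <;> norm_num
        _ = p := by simp [ZMod.card]
    refine h1.trans ?_
    have h2 : √(p : ℝ) ≤ 10 * Fintype.card ι := by
      rw [Real.sqrt_le_left (by positivity)]
      have : (p : ℝ) < 100 * Fintype.card ι ^ 2 := by exact_mod_cast hlarge
      nlinarith
    have h3 := Real.mul_self_sqrt hpR
    nlinarith [Real.sqrt_nonneg (p : ℝ)]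

end Stepanov

section Burgess

open Classical in
theorem card_filter_even_fibers_le {α : Type*} (s : Finset α) (r : ℕ) :
    ((Fintype.piFinset fun _ : Fin (2 * r) => s).filter
      fun b => ∀ β, Even (Finset.univ.filter fun i => b i = β).card).card
      ≤ s.card ^ r * r ^ (2 * r) := by
  classical
  set D := (Fintype.piFinset fun _ : Fin r => s) ×ˢ (Finset.univ : Finset (Fin (2 * r) → Fin r))
    with hD
  have hDc : D.card = s.card ^ r * r ^ (2 * r) := by
    rw [hD, Finset.card_product, Fintype.card_piFinset]
    simp
  rw [← hDc]
  refine Finset.card_le_card_of_surjOn (fun cφ => cφ.1 ∘ cφ.2) ?_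
  intro b hb
  rw [Finset.mem_coe, Finset.mem_filter, Fintype.mem_piFinset] at hb
  obtain ⟨hbs, hev⟩ := hb
  rcases Nat.eq_zero_or_pos r with rfl | hr
  · refine ⟨(fun i => b i, fun i => i), ?_, by ext i; exact i.elim0⟩
    rw [Finset.mem_coe, hD, Finset.mem_product, Fintype.mem_piFinset]
    exact ⟨fun i => i.elim0, Finset.mem_univ _⟩
  have himg : (Finset.univ.image b).card ≤ r := by
    have h1 : (Finset.univ : Finset (Fin (2 * r))).card
        = ∑ β ∈ Finset.univ.image b, (Finset.univ.filter fun i => b i = β).card :=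
      Finset.card_eq_sum_card_fiberwise fun i _ => Finset.mem_image_of_mem b (Finset.mem_univ i)
    have h2 : (Finset.univ.image b).card • 2
        ≤ ∑ β ∈ Finset.univ.image b, (Finset.univ.filter fun i => b i = β).card := by
      refine Finset.card_nsmul_le_sum _ _ _ fun β hβ => ?_
      obtain ⟨i, -, hi⟩ := Finset.mem_image.1 hβ
      have hpos : 0 < (Finset.univ.filter fun i => b i = β).card :=
        Finset.card_pos.2 ⟨i, Finset.mem_filter.2 ⟨Finset.mem_univ _, hi⟩⟩
      obtain ⟨k, hk⟩ := hev β
      omega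
    rw [Finset.card_univ, Fintype.card_fin] at h1
    rw [smul_eq_mul] at h2
    omega
  have hemb : Nonempty ((Finset.univ.image b : Finset α) ↪ Fin r) := by
    rw [Function.Embedding.nonempty_iff_card_le]
    simpa using himg
  obtain ⟨e⟩ := hemb
  have hmem : ∀ i, b i ∈ Finset.univ.image b := fun i =>
    Finset.mem_image_of_mem b (Finset.mem_univ i)
  let i₀ : Fin (2 * r) := ⟨0, by omega⟩
  refine ⟨(Function.extend e Subtype.val fun _ => b i₀, fun i => e ⟨b i, hmem i⟩), ?_, ?_⟩
  · rw [Finset.mem_coe, hD, Finset.mem_product, Fintype.mem_piFinset]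
    refine ⟨fun j => ?_, Finset.mem_univ _⟩
    by_cases hj : ∃ x, e x = j
    · obtain ⟨⟨x, hx⟩, rfl⟩ := hj
      dsimp only
      rw [e.injective.extend_apply]
      obtain ⟨i, -, rfl⟩ := Finset.mem_image.1 hx
      exact hbs i
    · dsimp only
      rw [Function.extend_apply' _ _ _ hj]
      exact hbs i₀
  · ext i
    exact e.injective.extend_apply Subtype.val (fun _ => b i₀) ⟨b i, hmem i⟩

theorem sum_pow_quadraticChar_le {p : ℕ} [Fact p.Prime] (hp2 : p ≠ 2) (s : Finset (ZMod p))
    (r : ℕ) :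
    ∑ u : ZMod p, (∑ b ∈ s, (quadraticChar (ZMod p) (u + b) : ℝ)) ^ (2 * r)
      ≤ s.card ^ r * r ^ (2 * r) * p + 200 * r * s.card ^ (2 * r) * √p := by
  classical
  set P := Fintype.piFinset fun _ : Fin (2 * r) => s with hP
  set E := P.filter fun b => ∀ β, Even (Finset.univ.filter fun i => b i = β).card with hE
  have hexp : ∑ u : ZMod p, (∑ b ∈ s, (quadraticChar (ZMod p) (u + b) : ℝ)) ^ (2 * r)
      = ∑ b ∈ P, ((∑ x : ZMod p, quadraticChar (ZMod p) (∏ i, (x + b i)) : ℤ) : ℝ) := by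
    simp_rw [Finset.sum_pow', ← hP]
    rw [Finset.sum_comm]
    refine Finset.sum_congr rfl fun b _ => ?_
    push_cast
    refine Finset.sum_congr rfl fun x _ => ?_
    rw [map_prod]
    push_cast
    rfl
  have htriv : ∀ y : ZMod p, (quadraticChar (ZMod p) y : ℝ) ≤ 1 := by
    intro y
    rcases quadraticChar_isQuadratic (ZMod p) y with h | h | h <;> rw [h] <;> norm_num
  rw [hexp, ← Finset.sum_filter_add_sum_filter_not P
    fun b => ∀ β, Even (Finset.univ.filter fun i => b i = β).card]
  refine add_le_add ?_ ?_
  · calc _ ≤ ∑ b ∈ E, (p : ℝ) := by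
          refine Finset.sum_le_sum fun b _ => ?_
          push_cast
          calc _ ≤ ∑ x : ZMod p, (1 : ℝ) := Finset.sum_le_sum fun x _ => htriv _
            _ = p := by simp [ZMod.card]
      _ = E.card * p := by simp
      _ ≤ _ := by
          refine mul_le_mul_of_nonneg_right ?_ (Nat.cast_nonneg p)
          have h := card_filter_even_fibers_le s r
          have h' : E.card ≤ s.card ^ r * r ^ (2 * r) := by convert h
          exact_mod_cast h'
  · calc _ ≤ ∑ b ∈ P.filter (fun b => ¬ ∀ β, Even (Finset.univ.filter fun i => b i = β).card),
            (200 * r * √p : ℝ) := by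
          refine Finset.sum_le_sum fun b hb => ?_
          obtain ⟨-, hb⟩ := Finset.mem_filter.1 hb
          push Not at hb
          obtain ⟨β, hβ⟩ := hb
          refine (le_abs_self _).trans
            ((abs_sum_quadraticChar_prod_le hp2 b β (by simpa using hβ)).trans ?_)
          rw [Fintype.card_fin]
          push_cast
          exact le_of_eq (by ring)
      _ ≤ P.card * (200 * r * √p) := by
          rw [Finset.sum_const, nsmul_eq_mul]
          refine mul_le_mul_of_nonneg_right ?_ (by positivity)
          exact_mod_cast Finset.card_filter_le _ _
      _ = _ := by
          rw [hP, Fintype.card_piFinset]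
          simp
          ring

end Burgess

section Burgess

theorem sum_nat_div_le_mul_harmonic (A N : ℕ) :
    ((∑ x ∈ Finset.Icc 1 A, N / x : ℕ) : ℝ) ≤ N * (1 + Real.log A) := by
  have h := harmonic_le_one_add_log A
  rw [harmonic_eq_sum_Icc] at h
  push_cast at h ⊢
  refine le_trans ?_ (mul_le_mul_of_nonneg_left h (Nat.cast_nonneg N))
  rw [Finset.mul_sum]
  refine Finset.sum_le_sum fun x _ => ?_
  rw [← div_eq_mul_inv]
  exact Nat.cast_div_le

/-- Multiplicative energy of two initial intervals. -/
theorem card_cross_mul_eq_le (A N : ℕ) :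
    ((((Finset.Icc 1 A ×ˢ Finset.Icc 1 N) ×ˢ (Finset.Icc 1 A ×ˢ Finset.Icc 1 N)).filter
      fun q => q.1.2 * q.2.1 = q.2.2 * q.1.1).card : ℝ) ≤ A * N * (1 + Real.log A) ^ 2 := by
  set D := ((Finset.Icc 1 A).sigma fun x => Finset.Icc 1 (A / x)) ×ˢ
    ((Finset.Icc 1 A).sigma fun y => Finset.Icc 1 (N / y)) with hD
  have hDc : D.card = (∑ x ∈ Finset.Icc 1 A, A / x) * (∑ y ∈ Finset.Icc 1 A, N / y) := by
    rw [hD, Finset.card_product, Finset.card_sigma, Finset.card_sigma]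
    simp
  have hlog : 0 ≤ 1 + Real.log A := by have := Real.log_natCast_nonneg A; linarith
  have hle : (((Finset.Icc 1 A ×ˢ Finset.Icc 1 N) ×ˢ (Finset.Icc 1 A ×ˢ Finset.Icc 1 N)).filter
      fun q => q.1.2 * q.2.1 = q.2.2 * q.1.1).card ≤ D.card := by
    refine Finset.card_le_card_of_surjOn
      (fun d => ((d.1.2 * d.1.1, d.2.2 * d.1.1), (d.1.2 * d.2.1, d.2.2 * d.2.1))) ?_
    rintro ⟨⟨a, n⟩, ⟨a', n'⟩⟩ hq
    simp only [Finset.coe_filter, Finset.mem_product, Finset.mem_Icc, Set.mem_ofPred_eq] at hq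
    obtain ⟨⟨⟨⟨ha, haA⟩, hn, hnN⟩, ⟨ha', haA'⟩, hn', hnN'⟩, h⟩ := hq
    obtain ⟨x, y, hxy, hax, hay⟩ := Nat.exists_coprime a a'
    set g := Nat.gcd a a' with hg
    have hgpos : 0 < g := Nat.gcd_pos_of_pos_left _ ha
    have hx : 0 < x := Nat.pos_of_ne_zero (by rintro rfl; omega)
    have hy : 0 < y := Nat.pos_of_ne_zero (by rintro rfl; omega)
    have h1 : n * y = n' * x := by
      refine Nat.eq_of_mul_eq_mul_right hgpos ?_
      calc n * y * g = n * (y * g) := by ring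
        _ = n' * (x * g) := by rw [← hay, ← hax, h]
        _ = _ := by ring
    obtain ⟨k, hk⟩ : x ∣ n := hxy.dvd_of_dvd_mul_right ⟨n', by rw [h1]; ring⟩
    have hk' : n' = k * y := by
      refine Nat.eq_of_mul_eq_mul_right hx ?_
      rw [← h1, hk]; ring
    have hkpos : 0 < k := Nat.pos_of_ne_zero (by rintro rfl; omega)
    refine ⟨(⟨x, g⟩, ⟨y, k⟩), ?_, ?_⟩
    · rw [Finset.mem_coe, hD]
      simp only [Finset.mem_product, Finset.mem_sigma, Finset.mem_Icc]
      refine ⟨⟨⟨hx, ?_⟩, hgpos, ?_⟩, ⟨hy, ?_⟩, hkpos, ?_⟩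
      · nlinarith
      · rw [Nat.le_div_iff_mul_le hx]; nlinarith
      · nlinarith
      · rw [Nat.le_div_iff_mul_le hy]; omega
    · simp only [Prod.mk.injEq]
      exact ⟨⟨by rw [hax]; ring, by rw [hk]; ring⟩, by rw [hay]; ring, hk'.symm⟩
  calc _ ≤ (D.card : ℝ) := by exact_mod_cast hle
    _ = ((∑ x ∈ Finset.Icc 1 A, A / x : ℕ) : ℝ) * ((∑ y ∈ Finset.Icc 1 A, N / y : ℕ) : ℝ) := by
        rw [hDc]; push_cast; rfl
    _ ≤ (A * (1 + Real.log A)) * (N * (1 + Real.log A)) :=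
        mul_le_mul (sum_nat_div_le_mul_harmonic A A) (sum_nat_div_le_mul_harmonic A N)
          (Nat.cast_nonneg _) (by positivity)
    _ = _ := by ring

theorem pow_sum_mul_le {α : Type*} (s : Finset α) (w T : α → ℝ) (hw : ∀ u ∈ s, 0 ≤ w u)
    (hT : ∀ u ∈ s, 0 ≤ T u) (r : ℕ) (hr : 1 ≤ r) :
    (∑ u ∈ s, w u * T u) ^ (2 * r)
      ≤ (∑ u ∈ s, w u) ^ (2 * r - 2) * (∑ u ∈ s, w u ^ 2) * ∑ u ∈ s, T u ^ (2 * r) := by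
  set S := ∑ u ∈ s, w u with hS
  have hS0 : 0 ≤ S := Finset.sum_nonneg hw
  have hV0 : 0 ≤ ∑ u ∈ s, w u * T u := Finset.sum_nonneg fun u hu => mul_nonneg (hw u hu) (hT u hu)
  have h1 : (∑ u ∈ s, w u * T u) ^ r ≤ S ^ (r - 1) * ∑ u ∈ s, w u * T u ^ r := by
    rcases hS0.eq_or_lt with h | h
    · have hz : ∀ u ∈ s, w u = 0 := (Finset.sum_eq_zero_iff_of_nonneg hw).1 (hS.symm.trans h.symm)
      have e1 : ∑ u ∈ s, w u * T u = 0 := Finset.sum_eq_zero fun u hu => by rw [hz u hu, zero_mul]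
      have e2 : ∑ u ∈ s, w u * T u ^ r = 0 :=
        Finset.sum_eq_zero fun u hu => by rw [hz u hu, zero_mul]
      rw [e1, e2, zero_pow (by omega), mul_zero]
    · have := Real.pow_arith_mean_le_arith_mean_pow s (fun u => w u / S) T
        (fun u hu => div_nonneg (hw u hu) hS0)
        (by rw [← Finset.sum_div, ← hS, div_self h.ne']) hT r
      simp_rw [div_mul_eq_mul_div] at this
      rw [← Finset.sum_div, ← Finset.sum_div, div_pow, div_le_div_iff₀ (by positivity) h] at this
      obtain ⟨k, rfl⟩ := Nat.exists_eq_add_of_le' hr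
      rw [Nat.add_sub_cancel]
      refine le_of_mul_le_mul_right ?_ h
      calc _ ≤ _ := this
        _ = _ := by ring
  have h2 : (∑ u ∈ s, w u * T u ^ r) ^ 2 ≤ (∑ u ∈ s, w u ^ 2) * ∑ u ∈ s, (T u ^ r) ^ 2 :=
    Finset.sum_mul_sq_le_sq_mul_sq s w fun u => T u ^ r
  calc (∑ u ∈ s, w u * T u) ^ (2 * r) = ((∑ u ∈ s, w u * T u) ^ r) ^ 2 := by
        rw [← pow_mul, mul_comm]
    _ ≤ (S ^ (r - 1) * ∑ u ∈ s, w u * T u ^ r) ^ 2 := by gcongr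
    _ = S ^ (2 * r - 2) * (∑ u ∈ s, w u * T u ^ r) ^ 2 := by
        rw [mul_pow, ← pow_mul]; congr 2; omega
    _ ≤ S ^ (2 * r - 2) * ((∑ u ∈ s, w u ^ 2) * ∑ u ∈ s, (T u ^ r) ^ 2) := by gcongr
    _ = _ := by
        rw [← mul_assoc]
        congr 1
        refine Finset.sum_congr rfl fun u _ => ?_
        rw [← pow_mul, mul_comm]

end Burgess

section Burgess

theorem abs_sum_Icc_shift_sub_le (f : ℕ → ℝ) (hf : ∀ n, |f n| ≤ 1) (N h : ℕ) :
    |∑ n ∈ Finset.Icc 1 N, f n - ∑ n ∈ Finset.Icc 1 N, f (n + h)| ≤ 2 * h := by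
  induction h with
  | zero => simp
  | succ h ih =>
    have key : ∑ n ∈ Finset.Icc 1 N, f (n + h) - ∑ n ∈ Finset.Icc 1 N, f (n + (h + 1))
        = f (1 + h) - f (N + (h + 1)) := by
      have e : ∀ j, ∑ n ∈ Finset.Icc 1 N, f (n + j) = ∑ n ∈ Finset.range N, f (n + 1 + j) := by
        intro j
        rw [Finset.range_eq_Ico, Finset.sum_Ico_add' (fun n => f (n + j)) 0 N 1]
        rfl
      rw [e, e, ← Finset.sum_sub_distrib]
      have := Finset.sum_range_sub' (fun n => f (n + 1 + h)) N
      rw [show 1 + h = 0 + 1 + h by ring, show N + (h + 1) = N + 1 + h by ring, ← this]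
      refine Finset.sum_congr rfl fun n _ => ?_
      rw [show n + 1 + (h + 1) = n + 1 + 1 + h by ring]
    calc _ = |(∑ n ∈ Finset.Icc 1 N, f n - ∑ n ∈ Finset.Icc 1 N, f (n + h))
          + (f (1 + h) - f (N + (h + 1)))| := by rw [← key]; congr 1; ring
      _ ≤ 2 * h + (1 + 1) := (abs_add_le _ _).trans
          (add_le_add ih ((abs_sub _ _).trans (add_le_add (hf _) (hf _))))
      _ = _ := by push_cast; ring

theorem abs_quadraticChar_le_one {p : ℕ} [Fact p.Prime] (y : ZMod p) :
    |(quadraticChar (ZMod p) y : ℝ)| ≤ 1 := by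
  rcases quadraticChar_isQuadratic (ZMod p) y with h | h | h <;> rw [h] <;> norm_num

theorem burgess_inequality {p : ℕ} [Fact p.Prime] (hp2 : p ≠ 2) (A B N r : ℕ) (hr : 1 ≤ r)
    (hAN : A * N < p) (hB : B < p) (hA : A < p) :
    ∃ V : ℝ, 0 ≤ V ∧
      V ^ (2 * r) ≤ (A * N : ℝ) ^ (2 * r - 2) * (A * N * (1 + Real.log A) ^ 2)
        * (B ^ r * r ^ (2 * r) * p + 200 * r * B ^ (2 * r) * √p) ∧
      A * B * |∑ n ∈ Finset.Icc 1 N, (quadraticChar (ZMod p) n : ℝ)| ≤ V + 2 * A ^ 2 * B ^ 2 := by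
  classical
  have hcast : ∀ a : ℕ, 1 ≤ a → a < p → (a : ZMod p) ≠ 0 := by
    intro a h1 h2 h0
    rw [ZMod.natCast_eq_zero_iff] at h0
    exact absurd (Nat.le_of_dvd h1 h0) (by omega)
  set χ : ZMod p → ℝ := fun y => (quadraticChar (ZMod p) y : ℝ) with hχ
  have hχmul : ∀ x y, χ (x * y) = χ x * χ y := by intro x y; simp only [hχ, map_mul]; push_cast; rfl
  have hχ1 : ∀ y, |χ y| ≤ 1 := abs_quadraticChar_le_one
  set s : Finset (ZMod p) := (Finset.Icc 1 B).image Nat.cast with hs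
  have hinj : Set.InjOn (Nat.cast : ℕ → ZMod p) (Finset.Icc 1 B : Finset ℕ) := by
    intro x hx y hy hxy
    simp only [Finset.coe_Icc, Set.mem_Icc] at hx hy
    rw [ZMod.natCast_eq_natCast_iff'] at hxy
    rwa [Nat.mod_eq_of_lt (by omega), Nat.mod_eq_of_lt (by omega)] at hxy
  have hsc : s.card = B := by rw [hs, Finset.card_image_of_injOn hinj]; simp
  set T : ZMod p → ℝ := fun u => ∑ b ∈ s, χ (u + b) with hT
  have hTeq : ∀ u, T u = ∑ b ∈ Finset.Icc 1 B, χ (u + (b : ZMod p)) := by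
    intro u; rw [hT, hs]; exact Finset.sum_image hinj
  set P := Finset.Icc 1 A ×ˢ Finset.Icc 1 N with hP
  set w : ℕ × ℕ → ZMod p := fun q => (q.2 : ZMod p) * (q.1 : ZMod p)⁻¹ with hw
  set ν : ZMod p → ℝ := fun u => ((P.filter fun q => w q = u).card : ℝ) with hν
  have hνsum : ∀ g : ZMod p → ℝ, ∑ u, ν u * g u = ∑ q ∈ P, g (w q) := by
    intro g
    rw [← Finset.sum_fiberwise P w fun q => g (w q)]
    refine Finset.sum_congr rfl fun u _ => ?_
    rw [hν, ← nsmul_eq_mul, ← Finset.sum_const]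
    refine Finset.sum_congr rfl fun q hq => ?_
    rw [(Finset.mem_filter.1 hq).2]
  have hν1 : ∑ u, ν u = A * N := by
    have := hνsum fun _ => 1
    simp only [mul_one, Finset.sum_const, nsmul_eq_mul] at this
    rw [this, hP]; simp
  have hν2 : ∑ u, ν u ^ 2 ≤ A * N * (1 + Real.log A) ^ 2 := by
    simp_rw [pow_two (ν _)]
    rw [hνsum ν]
    refine le_trans (le_of_eq ?_) (card_cross_mul_eq_le A N)
    rw [Finset.card_filter, ← hP, Finset.sum_product (s := P)]
    push_cast
    refine Finset.sum_congr rfl fun q hq => ?_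
    rw [hν]
    simp only
    rw [Finset.card_filter]
    push_cast
    refine Finset.sum_congr rfl fun q' hq' => ?_
    refine if_congr ?_ rfl rfl
    rw [hP, Finset.mem_product, Finset.mem_Icc, Finset.mem_Icc] at hq hq'
    have h1 := hcast q.1 (by omega) (by omega)
    have h2 := hcast q'.1 (by omega) (by omega)
    simp only [hw]
    rw [← div_eq_mul_inv, ← div_eq_mul_inv, div_eq_div_iff h2 h1, ← Nat.cast_mul, ← Nat.cast_mul,
      ZMod.natCast_eq_natCast_iff']
    have b1 : q'.2 * q.1 < p := by nlinarith
    have b2 : q.2 * q'.1 < p := by nlinarith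
    rw [Nat.mod_eq_of_lt b1, Nat.mod_eq_of_lt b2]
    exact eq_comm
  refine ⟨∑ u, ν u * |T u|, Finset.sum_nonneg fun u _ => by positivity, ?_, ?_⟩
  · refine (pow_sum_mul_le Finset.univ ν (fun u => |T u|) (fun u _ => by positivity)
      (fun u _ => abs_nonneg _) r hr).trans ?_
    rw [hν1]
    have h3 := sum_pow_quadraticChar_le hp2 s r
    rw [hsc] at h3
    have h4 : ∑ u, |T u| ^ (2 * r) = ∑ u, T u ^ (2 * r) :=
      Finset.sum_congr rfl fun u _ => by rw [(even_two_mul r).pow_abs]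
    rw [h4]
    exact mul_le_mul (mul_le_mul_of_nonneg_left hν2 (by positivity)) h3
      (Finset.sum_nonneg fun u _ => (even_two_mul r).pow_nonneg _) (by positivity)
  · set S := ∑ n ∈ Finset.Icc 1 N, χ n with hS
    have hdiff : |A * B * S - ∑ a ∈ Finset.Icc 1 A, ∑ b ∈ Finset.Icc 1 B,
        ∑ n ∈ Finset.Icc 1 N, χ ((n + a * b : ℕ) : ZMod p)| ≤ 2 * A ^ 2 * B ^ 2 := by
      have e : (A * B * S : ℝ) = ∑ a ∈ Finset.Icc 1 A, ∑ b ∈ Finset.Icc 1 B, S := by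
        simp; ring
      rw [e, ← Finset.sum_sub_distrib]
      simp_rw [← Finset.sum_sub_distrib (s := Finset.Icc 1 B)]
      calc _ ≤ ∑ a ∈ Finset.Icc 1 A, ∑ b ∈ Finset.Icc 1 B, (2 * (A * B) : ℝ) := by
            refine (Finset.abs_sum_le_sum_abs _ _).trans (Finset.sum_le_sum fun a ha => ?_)
            refine (Finset.abs_sum_le_sum_abs _ _).trans (Finset.sum_le_sum fun b hb => ?_)
            rw [Finset.mem_Icc] at ha hb
            refine (abs_sum_Icc_shift_sub_le (fun n => χ (n : ZMod p)) (fun n => hχ1 _) N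
              (a * b)).trans ?_
            have : a * b ≤ A * B := Nat.mul_le_mul ha.2 hb.2
            have : ((a * b : ℕ) : ℝ) ≤ (A * B : ℕ) := by exact_mod_cast this
            push_cast at this ⊢
            linarith
        _ = _ := by simp; ring
    have hmain : |∑ a ∈ Finset.Icc 1 A, ∑ b ∈ Finset.Icc 1 B,
        ∑ n ∈ Finset.Icc 1 N, χ ((n + a * b : ℕ) : ZMod p)| ≤ ∑ u, ν u * |T u| := by
      rw [hνsum fun u => |T u|, hP, Finset.sum_product]
      refine (Finset.abs_sum_le_sum_abs _ _).trans (Finset.sum_le_sum fun a ha => ?_)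
      rw [Finset.sum_comm]
      refine (Finset.abs_sum_le_sum_abs _ _).trans (Finset.sum_le_sum fun n hn => ?_)
      rw [Finset.mem_Icc] at ha
      have ha0 := hcast a ha.1 (by omega)
      have e : ∑ b ∈ Finset.Icc 1 B, χ ((n + a * b : ℕ) : ZMod p) = χ a * T (w (a, n)) := by
        rw [hTeq, Finset.mul_sum]
        refine Finset.sum_congr rfl fun b _ => ?_
        rw [← hχmul]
        congr 1
        push_cast
        simp only [hw]
        field_simp
      rw [e, abs_mul]
      exact mul_le_of_le_one_left (abs_nonneg _) (hχ1 _)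
    have e3 : (A * B * |S| : ℝ) = |A * B * S| := by
      rw [abs_mul, abs_of_nonneg (by positivity : (0 : ℝ) ≤ A * B)]
    rw [e3]
    have := abs_sub_abs_le_abs_sub (A * B * S) (∑ a ∈ Finset.Icc 1 A, ∑ b ∈ Finset.Icc 1 B,
        ∑ n ∈ Finset.Icc 1 N, χ ((n + a * b : ℕ) : ZMod p))
    linarith

end Burgess

section Burgess

set_option maxHeartbeats 1000000 in
/-- Burgess: the quadratic character cancels on initial intervals longer than `p ^ (1 / 4)`. -/
theorem abs_sum_quadraticChar_Icc_le (κ δ : ℝ) (hκ : 0 < κ) (hκ1 : κ ≤ 1) (hδ : 0 < δ)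
    (hδ1 : δ ≤ 1) :
    ∃ p₀ : ℕ, ∀ p : ℕ, p₀ ≤ p → ∀ _ : Fact p.Prime, ∀ N : ℕ, (p : ℝ) ^ (1 / 4 + δ) ≤ N →
      (N : ℝ) ≤ (p : ℝ) ^ (1 / 2 : ℝ) →
      |∑ n ∈ Finset.Icc 1 N, (quadraticChar (ZMod p) n : ℝ)| ≤ κ * N := by
  set r : ℕ := ⌈1 / δ⌉₊ with hr
  have hrδ : 1 / δ ≤ r := Nat.le_ceil _
  have hr1 : 1 ≤ r := Nat.one_le_iff_ne_zero.2 (Nat.ceil_pos.2 (by positivity)).ne'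
  have hr1R : (1 : ℝ) ≤ r := by exact_mod_cast hr1
  set t : ℝ := 1 / (2 * r) with ht
  have htpos : 0 < t := by positivity
  have ht1 : t ≤ δ / 2 := by
    rw [ht, div_le_div_iff₀ (by positivity) (by positivity)]
    rw [div_le_iff₀ hδ] at hrδ
    linarith
  have htr : t * r = 1 / 2 := by rw [ht]; field_simp
  set K : ℝ := r ^ (2 * r) + 200 * r with hK
  have hKpos : 0 < K := by positivity
  set c : ℝ := (κ / 2) ^ (2 * r) * (κ / 16) / (4 * K) with hc
  have hcpos : 0 < c := by positivity
  have ev1 : ∀ᶠ x : ℝ in Filter.atTop, Real.log x ^ (2 : ℝ) ≤ c * x ^ (3 * δ / 2) := by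
    have h := (isLittleO_log_rpow_rpow_atTop (2 : ℝ) (by positivity : 0 < 3 * δ / 2)).bound hcpos
    filter_upwards [h, Filter.eventually_ge_atTop 0] with x hx hx0
    rw [Real.norm_eq_abs, Real.norm_eq_abs, abs_of_nonneg (Real.rpow_nonneg hx0 _)] at hx
    exact (le_abs_self _).trans hx
  have ev2 : ∀ᶠ x : ℝ in Filter.atTop, 8 / κ ≤ x ^ (1 / 4 : ℝ) :=
    (tendsto_rpow_atTop (by norm_num)).eventually_ge_atTop _
  have ev := (tendsto_natCast_atTop_atTop (R := ℝ)).eventually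
    ((ev1.and ev2).and (Filter.eventually_ge_atTop 16))
  obtain ⟨p₀, hp₀⟩ := Filter.eventually_atTop.1 ev
  refine ⟨p₀, fun p hp hfact N hN1 hN2 => ?_⟩
  obtain ⟨⟨e1, e2⟩, e3⟩ := hp₀ p hp
  have hp1 : (1 : ℝ) ≤ p := by linarith
  have hp0 : (0 : ℝ) < p := by linarith
  have hp2 : p ≠ 2 := by rintro rfl; norm_num at e3
  have hsq : (p : ℝ) ^ (1 / 2 : ℝ) = √p := (Real.sqrt_eq_rpow _).symm
  have hsqsq : √(p : ℝ) * √p = p := Real.mul_self_sqrt hp0.le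
  have hsq4 : 4 ≤ √(p : ℝ) := Real.le_sqrt_of_sq_le (by norm_num; exact_mod_cast e3)
  rw [hsq] at hN2
  set B : ℕ := ⌈(p : ℝ) ^ t⌉₊ with hB
  have hpt : 1 ≤ (p : ℝ) ^ t := Real.one_le_rpow hp1 htpos.le
  have hB1 : (p : ℝ) ^ t ≤ B := Nat.le_ceil _
  have hB2 : (B : ℝ) ≤ 2 * (p : ℝ) ^ t := by
    have := (Nat.ceil_lt_add_one (Real.rpow_nonneg hp0.le t)).le
    linarith
  have hBpos : (0 : ℝ) < B := by linarith
  have hptsq : (p : ℝ) ^ t ≤ √p := by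
    rw [← hsq]; exact Real.rpow_le_rpow_of_exponent_le hp1 (by linarith)
  have hBp : (B : ℝ) < p := by
    have : 4 * √(p : ℝ) ≤ √p * √p := mul_le_mul_of_nonneg_right hsq4 (Real.sqrt_nonneg _)
    linarith
  have hBr : √(p : ℝ) ≤ (B : ℝ) ^ r := by
    calc √(p : ℝ) = ((p : ℝ) ^ t) ^ r := by
          rw [← Real.rpow_natCast, ← Real.rpow_mul hp0.le, htr, hsq]
      _ ≤ _ := by gcongr
  set A : ℕ := ⌊κ * N / (4 * B)⌋₊ with hA
  have hNpos : (0 : ℝ) < N := lt_of_lt_of_le (Real.rpow_pos_of_pos hp0 _) hN1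
  have hA1 : (A : ℝ) ≤ κ * N / (4 * B) := Nat.floor_le (by positivity)
  have hbig : 1 ≤ κ * N / (4 * B) := by
    rw [le_div_iff₀ (by positivity), one_mul]
    have h1 : (p : ℝ) ^ (1 / 4 : ℝ) * (p : ℝ) ^ t ≤ N := by
      rw [← Real.rpow_add hp0]
      exact (Real.rpow_le_rpow_of_exponent_le hp1 (by linarith)).trans hN1
    rw [div_le_iff₀ hκ] at e2
    calc 4 * (B : ℝ) ≤ 4 * (2 * (p : ℝ) ^ t) := by gcongr
      _ = 8 * (p : ℝ) ^ t := by ring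
      _ ≤ (p : ℝ) ^ (1 / 4 : ℝ) * κ * (p : ℝ) ^ t := by gcongr
      _ = κ * ((p : ℝ) ^ (1 / 4 : ℝ) * (p : ℝ) ^ t) := by ring
      _ ≤ _ := by gcongr
  have hA2 : κ * N / (8 * B) ≤ A := by
    have h1 := (Nat.lt_floor_add_one (κ * N / (4 * B))).le
    have h2 : κ * N / (8 * B) = κ * N / (4 * B) / 2 := by field_simp; norm_num
    have h3 : (1 : ℝ) ≤ A := by
      have : 1 ≤ A := (Nat.one_le_floor_iff _).2 hbig
      exact_mod_cast this
    rw [h2]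
    linarith
  have hApos : (0 : ℝ) < A := lt_of_lt_of_le (by positivity) hA2
  have hAB : (A : ℝ) * B ≤ κ * N / 4 := by
    rw [le_div_iff₀ (by positivity)] at hA1
    linarith
  have hB1' : 1 ≤ (B : ℝ) := hpt.trans hB1
  have hN1' : (1 : ℝ) ≤ N := (Real.one_le_rpow hp1 (by positivity)).trans hN1
  have hAle' : (A : ℝ) ≤ N / 4 := by
    have h1 : (A : ℝ) ≤ A * B := le_mul_of_one_le_right hApos.le hB1'
    have h2 : κ * N ≤ N := mul_le_of_le_one_left hNpos.le hκ1
    linarith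
  have hNN : (N : ℝ) * N ≤ p := by
    rw [← hsqsq]
    exact mul_le_mul hN2 hN2 hNpos.le (Real.sqrt_nonneg _)
  have hANp : (A : ℝ) * N < p := by
    have : (A : ℝ) * N ≤ N / 4 * N := mul_le_mul_of_nonneg_right hAle' hNpos.le
    linarith
  have hAp : (A : ℝ) < p :=
    (le_mul_of_one_le_right hApos.le hN1').trans_lt hANp
  obtain ⟨V, hV0, hV1, hV2⟩ := burgess_inequality hp2 A B N r hr1 (by exact_mod_cast hANp)
    (by exact_mod_cast hBp) (by exact_mod_cast hAp)
  have hlog1 : 1 ≤ Real.log p := by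
    rw [Real.le_log_iff_exp_le hp0]
    linarith [Real.exp_one_lt_d9]
  have hH : (1 + Real.log A) ^ 2 ≤ 4 * Real.log p ^ (2 : ℝ) := by
    have h1 : Real.log A ≤ Real.log p := Real.log_le_log hApos hAp.le
    have h2 : 0 ≤ Real.log A := Real.log_natCast_nonneg A
    rw [Real.rpow_two]
    calc (1 + Real.log A) ^ 2 ≤ (2 * Real.log p) ^ 2 := by gcongr; linarith
      _ = _ := by ring
  have hANlow : κ / 16 * (√p * (p : ℝ) ^ (3 * δ / 2)) ≤ A * N := by
    have h1 : √p * (p : ℝ) ^ (3 * δ / 2) * (p : ℝ) ^ t ≤ N * N := by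
      rw [← hsq, ← Real.rpow_add hp0, ← Real.rpow_add hp0]
      calc _ ≤ (p : ℝ) ^ ((1 / 4 + δ) + (1 / 4 + δ)) :=
            Real.rpow_le_rpow_of_exponent_le hp1 (by linarith)
        _ ≤ _ := by
            rw [Real.rpow_add hp0]
            exact mul_le_mul hN1 hN1 (by positivity) hNpos.le
    have h2 : κ * N / (8 * B) * N ≤ A * N := mul_le_mul_of_nonneg_right hA2 hNpos.le
    refine le_trans ?_ h2
    rw [div_mul_eq_mul_div (κ * (N : ℝ)), le_div_iff₀ (by positivity)]
    have h3 : 0 ≤ √p * (p : ℝ) ^ (3 * δ / 2) := by positivity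
    calc κ / 16 * (√p * (p : ℝ) ^ (3 * δ / 2)) * (8 * B)
        ≤ κ / 16 * (√p * (p : ℝ) ^ (3 * δ / 2)) * (8 * (2 * (p : ℝ) ^ t)) := by gcongr
      _ = κ * (√p * (p : ℝ) ^ (3 * δ / 2) * (p : ℝ) ^ t) := by ring
      _ ≤ κ * (N * N) := by gcongr
      _ = _ := by ring
  have hkey : (1 + Real.log A) ^ 2 * √p * K ≤ (κ / 2) ^ (2 * r) * (A * N) := by
    calc _ ≤ 4 * (c * (p : ℝ) ^ (3 * δ / 2)) * √p * K := by
          gcongr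
          exact hH.trans (by gcongr)
      _ = (κ / 2) ^ (2 * r) * (κ / 16 * (√p * (p : ℝ) ^ (3 * δ / 2))) := by
          rw [hc]; field_simp
      _ ≤ _ := by gcongr
  have hVle : V ≤ κ / 2 * (A * B * N) := by
    refine le_of_pow_le_pow_left₀ (by omega : 2 * r ≠ 0) (by positivity) (hV1.trans ?_)
    have h1 : (B : ℝ) ^ r * r ^ (2 * r) * p + 200 * r * B ^ (2 * r) * √p
        ≤ B ^ (2 * r) * √p * K := by
      have h2 : (B : ℝ) ^ r * p ≤ B ^ (2 * r) * √p := by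
        calc (B : ℝ) ^ r * p = B ^ r * (√p * √p) := by rw [hsqsq]
          _ ≤ B ^ r * (B ^ r * √p) := by gcongr
          _ = _ := by ring
      calc _ = ((B : ℝ) ^ r * p) * r ^ (2 * r) + 200 * r * B ^ (2 * r) * √p := by ring
        _ ≤ (B ^ (2 * r) * √p) * r ^ (2 * r) + 200 * r * B ^ (2 * r) * √p := by gcongr
        _ = _ := by rw [hK]; ring
    have h3 : (A * N : ℝ) ^ (2 * r) = (A * N : ℝ) ^ (2 * r - 2) * (A * N) * (A * N) := by
      obtain ⟨k, hk⟩ := Nat.exists_eq_add_of_le' hr1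
      rw [hk, show 2 * (k + 1) - 2 = 2 * k by omega]
      ring
    calc _ ≤ (A * N : ℝ) ^ (2 * r - 2) * (A * N * (1 + Real.log A) ^ 2)
            * (B ^ (2 * r) * √p * K) := by gcongr
      _ = (A * N : ℝ) ^ (2 * r - 2) * (A * N) * B ^ (2 * r)
            * ((1 + Real.log A) ^ 2 * √p * K) := by ring
      _ ≤ (A * N : ℝ) ^ (2 * r - 2) * (A * N) * B ^ (2 * r)
            * ((κ / 2) ^ (2 * r) * (A * N)) := by gcongr
      _ = (κ / 2) ^ (2 * r) * B ^ (2 * r) * (A * N : ℝ) ^ (2 * r) := by rw [h3]; ring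
      _ = _ := by rw [← mul_pow, ← mul_pow]; ring
  refine le_of_mul_le_mul_left ?_ (mul_pos hApos hBpos)
  calc _ ≤ _ := hV2
    _ ≤ κ / 2 * (A * B * N) + 2 * (A * B) * (A * B) := by linarith
    _ ≤ κ / 2 * (A * B * N) + 2 * (A * B) * (κ * N / 4) := by gcongr
    _ = _ := by ring

end Burgess

section Mertens

theorem log_factorial_eq_sum_primesLE (n : ℕ) :
    Real.log (n.factorial : ℝ)
      = ∑ q ∈ Nat.primesLE n, (n.factorial.factorization q : ℝ) * Real.log q := by
  rw [Real.log_nat_eq_sum_factorization]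
  refine Finsupp.sum_of_support_subset _ (fun q hq => ?_) _ (fun q _ => by simp)
  rw [Nat.support_factorization, Nat.mem_primeFactors] at hq
  exact Nat.mem_primesLE.2 ⟨(hq.1.dvd_factorial).1 hq.2.1, hq.1⟩

theorem sum_log_div_le (n : ℕ) (hn : 1 ≤ n) :
    ∑ q ∈ Nat.primesLE n, Real.log q / q ≤ Real.log n + Real.log 4 := by
  have hn0 : (0 : ℝ) < n := by exact_mod_cast hn
  have h1 : ∀ q ∈ Nat.primesLE n,
      (n / q - 1 : ℝ) * Real.log q ≤ (n.factorial.factorization q : ℝ) * Real.log q := by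
    intro q hq
    rw [Nat.mem_primesLE] at hq
    refine mul_le_mul_of_nonneg_right ?_ (Real.log_natCast_nonneg q)
    have h2 : n / q ≤ n.factorial.factorization q := by
      rw [Nat.factorization_factorial hq.2 (Nat.lt_succ_self _)]
      have hmem : 1 ∈ Finset.Ico 1 (Nat.log q n).succ := by simp [Nat.log_pos hq.2.one_lt hq.1]
      simpa using Finset.single_le_sum (f := fun i => n / q ^ i) (fun i _ => Nat.zero_le _) hmem
    have h3 : (n / q - 1 : ℝ) < (n / q : ℕ) := by
      have := Nat.lt_floor_add_one ((n : ℝ) / q)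
      rw [Nat.floor_div_natCast, Nat.floor_natCast] at this
      linarith
    have h4 : ((n / q : ℕ) : ℝ) ≤ n.factorial.factorization q := by exact_mod_cast h2
    linarith
  have h5 := Finset.sum_le_sum h1
  rw [← log_factorial_eq_sum_primesLE] at h5
  have h6 : Real.log n.factorial ≤ n * Real.log n := by
    rw [← Real.log_pow]
    refine Real.log_le_log (by exact_mod_cast n.factorial_pos) ?_
    exact_mod_cast Nat.factorial_le_pow n
  have h7 := Chebyshev.theta_le_log4_mul_x hn0.le
  rw [Chebyshev.theta_eq_sum_primesLE_log] at h7
  have h8 : ∑ q ∈ Nat.primesLE n, (n / q - 1 : ℝ) * Real.log q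
      = n * ∑ q ∈ Nat.primesLE n, Real.log q / q - ∑ q ∈ Nat.primesLE n, Real.log q := by
    rw [Finset.mul_sum, ← Finset.sum_sub_distrib]
    exact Finset.sum_congr rfl fun q _ => by ring
  refine le_of_mul_le_mul_left ?_ hn0
  linarith

theorem exists_le_sum_log_div :
    ∃ C : ℝ, ∀ n : ℕ, 1 ≤ n → Real.log n - C ≤ ∑ q ∈ Nat.primesLE n, Real.log q / q := by
  set g : ℕ → ℝ := fun m => 4 * (1 / (m : ℝ) ^ (3 / 2 : ℝ)) with hg
  have hgs : Summable g := (Real.summable_one_div_nat_rpow.2 (by norm_num)).mul_left 4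
  have hg0 : ∀ m, 0 ≤ g m := fun m => by positivity
  refine ⟨1 + ∑' m, g m, fun n hn => ?_⟩
  have hn0 : (0 : ℝ) < n := by exact_mod_cast hn
  have h1 : ∀ q ∈ Nat.primesLE n,
      (n.factorial.factorization q : ℝ) * Real.log q ≤ n * (Real.log q / q) + n * g q := by
    intro q hq
    rw [Nat.mem_primesLE] at hq
    have hq2 : (2 : ℝ) ≤ q := by exact_mod_cast hq.2.two_le
    have hv : (n.factorial.factorization q : ℝ) ≤ n / (q - 1) := by
      rw [le_div_iff₀ (by linarith)]
      have := Nat.sub_one_mul_factorization_factorial (n := n) hq.2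
      have h2 : (q - 1) * n.factorial.factorization q ≤ n := by omega
      have h3 : (((q - 1) * n.factorial.factorization q : ℕ) : ℝ) ≤ n := by exact_mod_cast h2
      rw [Nat.cast_mul, Nat.cast_sub hq.2.one_le] at h3
      push_cast at h3
      linarith
    have hlog0 : 0 ≤ Real.log q := Real.log_natCast_nonneg q
    have hlog : Real.log q ≤ 2 * (q : ℝ) ^ (1 / 2 : ℝ) := by
      have := Real.log_le_rpow_div (by linarith : (0 : ℝ) ≤ q) (by norm_num : (0 : ℝ) < 1 / 2)
      linarith
    have hpow : (q : ℝ) ^ (3 / 2 : ℝ) * (q : ℝ) ^ (1 / 2 : ℝ) = q ^ 2 := by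
      rw [← Real.rpow_add (by linarith)]; norm_num
    have hgq : Real.log q / (q * (q - 1)) ≤ g q := by
      rw [hg]
      simp only
      have hqpos : 0 < (q : ℝ) ^ (3 / 2 : ℝ) := by positivity
      rw [mul_one_div, div_le_div_iff₀ (by nlinarith) hqpos]
      calc Real.log q * (q : ℝ) ^ (3 / 2 : ℝ)
          ≤ 2 * (q : ℝ) ^ (1 / 2 : ℝ) * (q : ℝ) ^ (3 / 2 : ℝ) := by gcongr
        _ = 2 * q ^ 2 := by rw [← hpow]; ring
        _ ≤ _ := by nlinarith
    calc _ ≤ n / (q - 1) * Real.log q := mul_le_mul_of_nonneg_right hv hlog0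
      _ = n * (Real.log q / q) + n * (Real.log q / (q * (q - 1))) := by
          have : (q : ℝ) - 1 ≠ 0 := by linarith
          field_simp
          ring
      _ ≤ _ := by gcongr
  have h5 := Finset.sum_le_sum h1
  rw [← log_factorial_eq_sum_primesLE, Finset.sum_add_distrib, ← Finset.mul_sum,
    ← Finset.mul_sum] at h5
  have h6 : n * Real.log n - n ≤ Real.log n.factorial := by
    have h := Stirling.le_log_factorial_stirling (n := n) (by omega)
    have h7 : 0 ≤ Real.log n := Real.log_natCast_nonneg n
    have h8 : 0 ≤ Real.log (2 * Real.pi) := Real.log_nonneg (by linarith [Real.pi_gt_three])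
    linarith
  have h9 : ∑ q ∈ Nat.primesLE n, g q ≤ ∑' m, g m := hgs.sum_le_tsum _ fun m _ => hg0 m
  have h10 := mul_le_mul_of_nonneg_left h9 hn0.le
  refine le_of_mul_le_mul_left ?_ hn0
  linarith

/-- Mertens' first theorem. -/
theorem exists_abs_sum_log_div_sub_log_le :
    ∃ C : ℝ, 0 < C ∧ ∀ n : ℕ, 1 ≤ n →
      |∑ q ∈ Nat.primesLE n, Real.log q / q - Real.log n| ≤ C := by
  obtain ⟨C, hC⟩ := exists_le_sum_log_div
  refine ⟨max (Real.log 4) C, lt_max_of_lt_left (Real.log_pos (by norm_num)), fun n hn => ?_⟩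
  rw [abs_le]
  have h1 := hC n hn
  have h2 := sum_log_div_le n hn
  have h3 := le_max_left (Real.log 4) C
  have h4 := le_max_right (Real.log 4) C
  constructor <;> linarith

theorem primesLE_succ_sum (f : ℕ → ℝ) (n : ℕ) :
    ∑ q ∈ Nat.primesLE (n + 1), f q
      = ∑ q ∈ Nat.primesLE n, f q + if (n + 1).Prime then f (n + 1) else 0 := by
  rw [Nat.primesLE_eq_filter_range, Nat.primesLE_eq_filter_range, Finset.sum_filter,
    Finset.sum_filter, Finset.sum_range_succ]

/-- The upper bound in Mertens' second theorem, over a window. -/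
theorem exists_sum_one_div_prime_le :
    ∃ C : ℝ, 0 < C ∧ ∀ Y X : ℕ, 2 ≤ Y → Y ≤ X →
      ∑ q ∈ (Finset.Ioc Y X).filter Nat.Prime, 1 / (q : ℝ)
        ≤ Real.log (Real.log X / Real.log Y) + C / Real.log Y := by
  obtain ⟨C, hC0, hC⟩ := exists_abs_sum_log_div_sub_log_le
  refine ⟨3 * C, by positivity, fun Y X hY hYX => ?_⟩
  set E : ℕ → ℝ := fun n => ∑ q ∈ Nat.primesLE n, Real.log q / q - Real.log n with hE
  have hpos : ∀ n : ℕ, 2 ≤ n → 0 < Real.log n := fun n hn => Real.log_pos (by exact_mod_cast hn)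
  have hmain : ∑ q ∈ (Finset.Ioc Y X).filter Nat.Prime, 1 / (q : ℝ)
      ≤ Real.log (Real.log X) - Real.log (Real.log Y) + E X / Real.log X - E Y / Real.log Y
        + C * (1 / Real.log Y - 1 / Real.log X) := by
    induction X, hYX using Nat.le_induction with
    | base => simp
    | succ X hYX ih =>
      have hl := hpos X (by omega)
      have hl' := hpos (X + 1) (by omega)
      set l := Real.log X with hldef
      set l' := Real.log ((X + 1 : ℕ) : ℝ) with hldef'
      have hll : l ≤ l' := Real.log_le_log (by exact_mod_cast (by omega : 0 < X)) (by simp)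
      have hstep : ∑ q ∈ (Finset.Ioc Y (X + 1)).filter Nat.Prime, 1 / (q : ℝ)
          = ∑ q ∈ (Finset.Ioc Y X).filter Nat.Prime, 1 / (q : ℝ)
            + (l' - l + E (X + 1) - E X) / l' := by
        have e : l' - l + E (X + 1) - E X = if (X + 1).Prime then l' / (X + 1 : ℕ) else 0 := by
          have := primesLE_succ_sum (fun q => Real.log q / q) X
          simp only [hE]
          rw [this]
          ring
        rw [e, Finset.sum_filter, Finset.sum_filter,
          ← Finset.insert_Ioc_right_eq_Ioc_add_one (by omega),
          Finset.sum_insert (by simp), add_comm]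
        congr 1
        split_ifs
        · field_simp
        · simp
      rw [hstep]
      have h1 : 1 - l / l' ≤ Real.log l' - Real.log l := by
        rw [← Real.log_div hl'.ne' hl.ne']
        have := Real.one_sub_inv_le_log_of_pos (div_pos hl' hl)
        rwa [inv_div] at this
      have h2 : E X * (1 / l - 1 / l') ≤ C * (1 / l - 1 / l') := by
        refine mul_le_mul_of_nonneg_right ((le_abs_self _).trans (hC X (by omega))) ?_
        rw [sub_nonneg]
        exact one_div_le_one_div_of_le hl hll
      have h3 : (l' - l + E (X + 1) - E X) / l' = 1 - l / l' + E (X + 1) / l' - E X / l' := by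
        field_simp
      have h4 : E X * (1 / l - 1 / l') = E X / l - E X / l' := by ring
      rw [h3]
      linarith
  have hlY := hpos Y hY
  have hlX := hpos X (by omega)
  have hll : Real.log Y ≤ Real.log X :=
    Real.log_le_log (by exact_mod_cast (by omega : 0 < Y)) (by exact_mod_cast hYX)
  have h1 : E X / Real.log X ≤ C / Real.log X := by
    gcongr; exact (le_abs_self _).trans (hC X (by omega))
  have h2 : -(C / Real.log Y) ≤ E Y / Real.log Y := by
    rw [← neg_div]
    gcongr
    exact neg_le_of_abs_le (hC Y (by omega))
  rw [Real.log_div hlX.ne' hlY.ne']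
  have h3 : C * (1 / Real.log Y - 1 / Real.log X) = C / Real.log Y - C / Real.log X := by ring
  have h4 : 3 * C / Real.log Y = C / Real.log Y + C / Real.log Y + C / Real.log Y := by ring
  have h5 : 0 < C / Real.log Y := by positivity
  linarith

end Mertens

section Windows

/-- The integers in `(C ^ j, C ^ (j + 1)]`. -/
def window (C j : ℕ) : Finset ℕ := Finset.Ioc (C ^ j) (C ^ (j + 1))

/-- The primes in `(C ^ i, C ^ (i + 1)]`. -/
def primeWindow (C i : ℕ) : Finset ℕ := (window C i).filter Nat.Prime

theorem mem_window {C j n : ℕ} : n ∈ window C j ↔ C ^ j < n ∧ n ≤ C ^ (j + 1) := Finset.mem_Ioc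

theorem mem_primeWindow {C i n : ℕ} : n ∈ primeWindow C i ↔ n ∈ window C i ∧ n.Prime :=
  Finset.mem_filter

theorem window_index_unique {C i j n : ℕ} (hC : 2 ≤ C) (hi : n ∈ window C i)
    (hj : n ∈ window C j) : i = j := by
  rw [mem_window] at hi hj
  have h1 : i < j + 1 := (Nat.pow_lt_pow_iff_right (by omega)).1 (hi.1.trans_le hj.2)
  have h2 : j < i + 1 := (Nat.pow_lt_pow_iff_right (by omega)).1 (hj.1.trans_le hi.2)
  omega

theorem pow_le_card_window {C : ℕ} (hC : 2 ≤ C) (j : ℕ) : C ^ j ≤ (window C j).card := by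
  rw [window, Nat.card_Ioc, pow_succ]
  have : C ^ j * 2 ≤ C ^ j * C := Nat.mul_le_mul_left _ hC
  omega

theorem card_window_le (C j : ℕ) : (window C j).card ≤ C ^ (j + 1) := by
  rw [window, Nat.card_Ioc]; omega

theorem exists_base_card_primeWindow :
    ∃ C : ℕ, 3 ≤ C ∧ ∀ i : ℕ,
      (C : ℝ) ^ i / ((i + 1) * Real.log C) ≤ (primeWindow C i).card := by
  obtain ⟨K, hK0, hK⟩ := exists_abs_sum_log_div_sub_log_le
  set C : ℕ := ⌈Real.exp (2 * K + 1)⌉₊ with hC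
  have hexp : Real.exp (2 * K + 1) ≤ C := Nat.le_ceil _
  have hC0 : (0 : ℝ) < C := (Real.exp_pos _).trans_le hexp
  have hlog : 2 * K + 1 ≤ Real.log C := (Real.le_log_iff_exp_le hC0).2 hexp
  have hC3 : 2 < C := by
    have h1 : Real.exp 1 ≤ Real.exp (2 * K + 1) := Real.exp_le_exp.2 (by linarith)
    have h2 := Real.exp_one_gt_d9
    have : (2 : ℝ) < C := by linarith
    exact_mod_cast this
  refine ⟨C, hC3, fun i => ?_⟩
  have hp : ∀ j, 1 ≤ C ^ j := fun j => Nat.one_le_pow _ _ (by omega)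
  have h1 := (abs_le.1 (hK (C ^ i) (hp i))).2
  have h2 := (abs_le.1 (hK (C ^ (i + 1)) (hp _))).1
  have hmono : C ^ i ≤ C ^ (i + 1) := Nat.pow_le_pow_right (by omega) (by omega)
  have hsplit : ∑ q ∈ Nat.primesLE (C ^ (i + 1)), Real.log q / q
      = ∑ q ∈ Nat.primesLE (C ^ i), Real.log q / q
        + ∑ q ∈ primeWindow C i, Real.log q / (q : ℝ) := by
    rw [← Finset.sum_union]
    · refine Finset.sum_congr ?_ fun _ _ => rfl
      ext q
      rw [Finset.mem_union, mem_primeWindow, mem_window, Nat.mem_primesLE, Nat.mem_primesLE]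
      constructor
      · rintro ⟨h, hq⟩
        rcases le_or_gt q (C ^ i) with h' | h'
        · exact Or.inl ⟨h', hq⟩
        · exact Or.inr ⟨⟨h', h⟩, hq⟩
      · rintro (⟨h, hq⟩ | ⟨⟨_, h⟩, hq⟩)
        · exact ⟨h.trans hmono, hq⟩
        · exact ⟨h, hq⟩
    · rw [Finset.disjoint_left]
      intro q hq hq'
      rw [mem_primeWindow, mem_window] at hq'
      rw [Nat.mem_primesLE] at hq
      omega
  have hterm : ∀ q ∈ primeWindow C i,
      Real.log q / (q : ℝ) ≤ (i + 1) * Real.log C / (C : ℝ) ^ i := by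
    intro q hq
    rw [mem_primeWindow, mem_window] at hq
    have hq1 : (C : ℝ) ^ i ≤ q := by exact_mod_cast hq.1.1.le
    have hq2 : (q : ℝ) ≤ (C : ℝ) ^ (i + 1) := by exact_mod_cast hq.1.2
    have hq0 : (0 : ℝ) < q := by exact_mod_cast hq.2.pos
    have : Real.log q ≤ (i + 1) * Real.log C := by
      have := Real.log_le_log hq0 hq2
      rw [Real.log_pow] at this
      push_cast at this
      exact this
    have h0 : 0 ≤ Real.log q := Real.log_natCast_nonneg q
    gcongr
  have hsum := Finset.sum_le_sum hterm
  rw [Finset.sum_const, nsmul_eq_mul] at hsum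
  push_cast at h1 h2
  rw [Real.log_pow] at h1 h2
  push_cast at h2
  have hone : 1 ≤ (primeWindow C i).card * ((i + 1) * Real.log C / (C : ℝ) ^ i) := by
    linarith
  have hlogpos : 0 < Real.log C := by linarith
  rw [div_le_iff₀ (by positivity)]
  rwa [← mul_div_assoc, le_div_iff₀ (by positivity), one_mul] at hone

theorem card_primeFactors_gt_le {C i L K n : ℕ} (hC : 2 ≤ C) (hn : n ≠ 0) (hnL : n < C ^ (L + 1))
    (hK : L + 1 ≤ K * i) : (n.primeFactors.filter fun q => C ^ i < q).card ≤ K := by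
  set s := n.primeFactors.filter fun q => C ^ i < q with hs
  have h1 : (C ^ i) ^ s.card ≤ ∏ q ∈ s, q :=
    Finset.pow_card_le_prod _ _ _ fun q hq => (Finset.mem_filter.1 hq).2.le
  have h2 : ∏ q ∈ s, q ≤ n := by
    refine Nat.le_of_dvd (Nat.pos_of_ne_zero hn) ?_
    exact (Finset.prod_dvd_prod_of_subset _ _ _ (Finset.filter_subset _ _)).trans
      (Nat.prod_primeFactors_dvd n)
  have h3 : C ^ (i * s.card) < C ^ (L + 1) := by
    rw [pow_mul]; omega
  have h4 : i * s.card < L + 1 := (Nat.pow_lt_pow_iff_right (by omega)).1 h3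
  by_contra! h
  nlinarith

theorem card_le_mul_of_prime_mul {α : Type*} (Z : Finset α) (P M : α → ℕ) (R : Finset ℕ)
    (y K : ℕ) (hR : ∀ n ∈ R, n ≠ 0 ∧ (n.primeFactors.filter fun q => y < q).card ≤ K)
    (hinj : ∀ z ∈ Z, ∀ z' ∈ Z, P z = P z' → M z = M z' → z = z')
    (hZ : ∀ z ∈ Z, (P z).Prime ∧ y < P z ∧ P z * M z ∈ R) : Z.card ≤ K * R.card := by
  classical
  refine Finset.card_le_mul_card_image_of_maps_to (f := fun z => P z * M z)
    (fun z hz => (hZ z hz).2.2) K fun n hn => le_trans ?_ (hR n hn).2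
  refine Finset.card_le_card_of_injOn P (fun z hz => ?_) fun z hz z' hz' h => ?_
  · obtain ⟨hz, hzn⟩ := Finset.mem_filter.1 hz
    obtain ⟨h1, h2, h3⟩ := hZ z hz
    rw [Finset.mem_coe, Finset.mem_filter, Nat.mem_primeFactors]
    exact ⟨⟨h1, ⟨M z, hzn.symm⟩, (hR n hn).1⟩, h2⟩
  · obtain ⟨hz, hzn⟩ := Finset.mem_filter.1 hz
    obtain ⟨hz', hzn'⟩ := Finset.mem_filter.1 hz'
    refine hinj z hz z' hz' h ?_
    rw [← h, ← hzn] at hzn'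
    exact (Nat.eq_of_mul_eq_mul_left (hZ z hz).1.pos hzn').symm

theorem card_le_mul_of_prime_mul_prime_mul {α : Type*} (Z : Finset α) (P Q M : α → ℕ)
    (R : Finset ℕ) (y K : ℕ)
    (hR : ∀ n ∈ R, n ≠ 0 ∧ (n.primeFactors.filter fun q => y < q).card ≤ K)
    (hinj : ∀ z ∈ Z, ∀ z' ∈ Z, P z = P z' → Q z = Q z' → M z = M z' → z = z')
    (hZ : ∀ z ∈ Z, (P z).Prime ∧ y < P z ∧ (Q z).Prime ∧ y < Q z ∧ P z * (Q z * M z) ∈ R) :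
    Z.card ≤ K * K * R.card := by
  classical
  refine Finset.card_le_mul_card_image_of_maps_to (f := fun z => P z * (Q z * M z))
    (fun z hz => (hZ z hz).2.2.2.2) (K * K) fun n hn => ?_
  refine le_trans ?_ (Nat.mul_le_mul (hR n hn).2 (hR n hn).2)
  rw [← Finset.card_product]
  refine Finset.card_le_card_of_injOn (fun z => (P z, Q z)) (fun z hz => ?_)
    fun z hz z' hz' h => ?_
  · obtain ⟨hz, hzn⟩ := Finset.mem_filter.1 hz
    obtain ⟨h1, h2, h3, h4, -⟩ := hZ z hz
    rw [Finset.mem_coe, Finset.mem_product, Finset.mem_filter, Finset.mem_filter,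
      Nat.mem_primeFactors, Nat.mem_primeFactors]
    exact ⟨⟨⟨h1, ⟨_, hzn.symm⟩, (hR n hn).1⟩, h2⟩,
      ⟨h3, ⟨P z * M z, by rw [← hzn]; ring⟩, (hR n hn).1⟩, h4⟩
  · obtain ⟨hz, hzn⟩ := Finset.mem_filter.1 hz
    obtain ⟨hz', hzn'⟩ := Finset.mem_filter.1 hz'
    obtain ⟨hP, hQ⟩ := Prod.mk.inj h
    refine hinj z hz z' hz' hP hQ ?_
    rw [← hP, ← hQ, ← hzn] at hzn'
    obtain ⟨h1, -, h3, -, -⟩ := hZ z hz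
    exact (Nat.eq_of_mul_eq_mul_left h3.pos (Nat.eq_of_mul_eq_mul_left h1.pos hzn')).symm

theorem two_mul_card_filter_mul_eq_one {α β : Type*} (S : Finset α) (T : Finset β) (f : α → ℤ)
    (g : β → ℤ) (hf : ∀ x ∈ S, f x = 1 ∨ f x = -1) (hg : ∀ x ∈ T, g x = 1 ∨ g x = -1) :
    2 * (((S ×ˢ T).filter fun z => f z.1 * g z.2 = 1).card : ℤ)
      = S.card * T.card + (∑ x ∈ S, f x) * ∑ x ∈ T, g x := by
  rw [Finset.card_filter, Finset.sum_mul_sum, ← Finset.sum_product', ← Nat.cast_mul,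
    ← Finset.card_product, Finset.card_eq_sum_ones]
  push_cast
  rw [Finset.mul_sum, ← Finset.sum_add_distrib]
  refine Finset.sum_congr rfl fun z hz => ?_
  rw [Finset.mem_product] at hz
  rcases hf z.1 hz.1 with h | h <;> rcases hg z.2 hz.2 with h' | h' <;> simp [h, h']

end Windows

section Doubling

/-- If `k` is almost always multiplicative-in-sign on pairs, then `k` is positive at almost every
even argument. -/
theorem card_nonpos_double_mul_le (k : ℕ → ℤ) (t : ℕ) (F : Finset (ℕ × ℕ))
    (hF : ∀ s u, t ≤ s → t ≤ u → s + u < 100 * t → k s * k u * k (s + u) ≤ 0 → (s, u) ∈ F) :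
    ((Finset.Ico (25 * t) (48 * t)).filter fun a => k (2 * a) ≤ 0).card * t
      ≤ 240 * F.card := by
  classical
  rcases Nat.eq_zero_or_pos t with rfl | ht
  · simp
  set bad := (Finset.Ico (25 * t) (48 * t)).filter fun a => k (2 * a) ≤ 0 with hbad
  set I := Finset.Ico t (2 * t) with hI
  set box := bad ×ˢ (I ×ˢ I) with hbox
  have hmem : ∀ z ∈ box, (25 * t ≤ z.1 ∧ z.1 < 48 * t) ∧ (t ≤ z.2.1 ∧ z.2.1 < 2 * t) ∧
      (t ≤ z.2.2 ∧ z.2.2 < 2 * t) := by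
    intro z hz
    simp only [hbox, hbad, hI, Finset.mem_product, Finset.mem_filter, Finset.mem_Ico] at hz
    tauto
  have hU : ∀ g : ℕ × ℕ × ℕ → (ℕ × ℕ) × ℕ, Set.InjOn g box → (∀ z ∈ box, (g z).2 < 48 * t) →
      (box.filter fun z => (g z).1 ∈ F).card ≤ F.card * (48 * t) := by
    intro g hg hlt
    have : F.card * (48 * t) = (F ×ˢ Finset.range (48 * t)).card := by simp
    rw [this]
    refine Finset.card_le_card_of_injOn g (fun z hz => ?_) fun z hz z' hz' h =>
      hg (Finset.mem_filter.1 hz).1 (Finset.mem_filter.1 hz').1 h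
    rw [Finset.mem_coe, Finset.mem_filter] at hz
    rw [Finset.mem_coe, Finset.mem_product, Finset.mem_range]
    exact ⟨hz.2, hlt z hz.1⟩
  have h1 := hU (fun z => ((2 * z.1, z.2.1 + z.2.2), z.2.1))
    (by rintro ⟨a, b, c⟩ - ⟨a', b', c'⟩ - h; simp only [Prod.mk.injEq] at h ⊢; omega)
    (fun z hz => by have := hmem z hz; simp only; omega)
  have h2 := hU (fun z => ((z.1 + z.2.1, z.1 + z.2.2), z.2.1))
    (by rintro ⟨a, b, c⟩ - ⟨a', b', c'⟩ - h; simp only [Prod.mk.injEq] at h ⊢; omega)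
    (fun z hz => by have := hmem z hz; simp only; omega)
  have h3 := hU (fun z => ((z.1, z.2.1), z.2.2))
    (by rintro ⟨a, b, c⟩ - ⟨a', b', c'⟩ - h; simp only [Prod.mk.injEq] at h ⊢; omega)
    (fun z hz => by have := hmem z hz; simp only; omega)
  have h4 := hU (fun z => ((z.1, z.2.2), z.2.1))
    (by rintro ⟨a, b, c⟩ - ⟨a', b', c'⟩ - h; simp only [Prod.mk.injEq] at h ⊢; omega)
    (fun z hz => by have := hmem z hz; simp only; omega)
  have h5 := hU (fun z => ((z.2.1, z.2.2), z.1))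
    (by rintro ⟨a, b, c⟩ - ⟨a', b', c'⟩ - h; simp only [Prod.mk.injEq] at h ⊢; omega)
    (fun z hz => by have := hmem z hz; simp only; omega)
  have hcover : box ⊆ (box.filter fun z => (2 * z.1, z.2.1 + z.2.2) ∈ F)
      ∪ ((box.filter fun z => (z.1 + z.2.1, z.1 + z.2.2) ∈ F)
      ∪ ((box.filter fun z => (z.1, z.2.1) ∈ F)
      ∪ ((box.filter fun z => (z.1, z.2.2) ∈ F) ∪ (box.filter fun z => (z.2.1, z.2.2) ∈ F)))) := by
    rintro ⟨a, b, c⟩ hz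
    have hb := hmem _ hz
    have hk : k (2 * a) ≤ 0 := by
      simp only [hbox, hbad, Finset.mem_product, Finset.mem_filter] at hz
      exact hz.1.2
    simp only at hb
    by_contra hcon
    simp only [Finset.mem_union, Finset.mem_filter, hz, true_and, not_or] at hcon
    obtain ⟨c1, c2, c3, c4, c5⟩ := hcon
    have hpos : ∀ s u, (s, u) ∉ F → t ≤ s → t ≤ u → s + u < 100 * t →
        0 < k s * k u * k (s + u) := by
      intro s u hsu h1 h2 h3
      by_contra hle
      exact hsu (hF s u h1 h2 h3 (not_lt.1 hle))
    have p1 := hpos _ _ c1 (by omega) (by omega) (by omega)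
    have p2 := hpos _ _ c2 (by omega) (by omega) (by omega)
    have p3 := hpos _ _ c3 (by omega) (by omega) (by omega)
    have p4 := hpos _ _ c4 (by omega) (by omega) (by omega)
    have p5 := hpos _ _ c5 (by omega) (by omega) (by omega)
    rw [show a + b + (a + c) = 2 * a + (b + c) by ring] at p2
    have key := mul_pos (mul_pos p1 p2) (mul_pos (mul_pos p3 p4) p5)
    have e : k (2 * a) * k (b + c) * k (2 * a + (b + c)) * (k (a + b) * k (a + c)
        * k (2 * a + (b + c))) * (k a * k b * k (a + b) * (k a * k c * k (a + c))
        * (k b * k c * k (b + c))) = k (2 * a) * (k (b + c) * k (2 * a + (b + c)) * k (a + b)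
          * k (a + c) * k a * k b * k c) ^ 2 := by ring
    rw [e] at key
    nlinarith [sq_nonneg (k (b + c) * k (2 * a + (b + c)) * k (a + b)
          * k (a + c) * k a * k b * k c)]
  have hcard := (Finset.card_le_card hcover).trans ((Finset.card_union_le _ _).trans
    (add_le_add h1 ((Finset.card_union_le _ _).trans (add_le_add h2 ((Finset.card_union_le _ _).trans
    (add_le_add h3 ((Finset.card_union_le _ _).trans (add_le_add h4 h5))))))))
  have hboxc : box.card = bad.card * (t * t) := by
    rw [hbox, Finset.card_product, Finset.card_product, hI, Nat.card_Ico,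
      show 2 * t - t = t by omega]
  rw [hboxc] at hcard
  refine Nat.le_of_mul_le_mul_right ?_ ht
  linarith

end Doubling

section Residues

/-- `f` is completely multiplicative and `±1`-valued on the positive integers. -/
structure IsSignCharacter (f : ℕ → ℤ) : Prop where
  map_mul : ∀ m n, 0 < m → 0 < n → f (m * n) = f m * f n
  eq_one_or : ∀ n, 0 < n → f n = 1 ∨ f n = -1

variable {f : ℕ → ℤ} {C L K x i₀ : ℕ}

theorem pos_of_mem_window {j n : ℕ} (h : n ∈ window C j) : 0 < n := by
  rw [mem_window] at h; omega

theorem card_primeFactors_residue_le (hC : 2 ≤ C) (hx : x < C ^ (L + 1)) (hK : L + 1 ≤ K * i₀) :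
    ∀ n ∈ (Finset.Icc 1 x).filter (fun n => f n = 1),
      n ≠ 0 ∧ (n.primeFactors.filter fun q => C ^ i₀ < q).card ≤ K := by
  intro n hn
  rw [Finset.mem_filter, Finset.mem_Icc] at hn
  exact ⟨by omega, card_primeFactors_gt_le hC (by omega) (by omega) hK⟩

theorem mul_mem_window_bound {i j p m : ℕ} (hC : 2 ≤ C) (hp : p ∈ window C i)
    (hm : m ∈ window C j) (hij : i + j + 2 ≤ L) : p * m ≤ C ^ L := by
  rw [mem_window] at hp hm
  calc p * m ≤ C ^ (i + 1) * C ^ (j + 1) := Nat.mul_le_mul hp.2 hm.2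
    _ = C ^ (i + j + 2) := by rw [← pow_add]; congr 1; ring
    _ ≤ _ := Nat.pow_le_pow_right (by omega) hij

theorem lt_of_mem_window_of_le {i n : ℕ} (hC : 2 ≤ C) (hn : n ∈ window C i) (hi : i₀ ≤ i) :
    C ^ i₀ < n := by
  rw [mem_window] at hn
  exact (Nat.pow_le_pow_right (by omega) hi).trans_lt hn.1

theorem pow_div_le_card_primeWindow {D : ℝ} (hD0 : 0 < D)
    (hD : ∀ i : ℕ, (C : ℝ) ^ i / ((i + 1) * D) ≤ (primeWindow C i).card) {i : ℕ}
    (hi : i + 1 ≤ L) : (C : ℝ) ^ i / (L * D) ≤ (primeWindow C i).card := by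
  refine le_trans ?_ (hD i)
  have : (i + 1 : ℝ) ≤ L := by exact_mod_cast hi
  gcongr

theorem card_single_mul_le (hf : IsSignCharacter f) (hC : 2 ≤ C) (hL : C ^ L ≤ x)
    (hx : x < C ^ (L + 1)) (hK : L + 1 ≤ K * i₀) {D : ℝ} (hD0 : 0 < D)
    (hD : ∀ i : ℕ, (C : ℝ) ^ i / ((i + 1) * D) ≤ (primeWindow C i).card) :
    (((Finset.Ico i₀ (L - 1)).filter fun i =>
        0 ≤ (∑ p ∈ primeWindow C i, f p) * ∑ m ∈ window C (L - 2 - i), f m).card : ℝ)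
      * ((C : ℝ) ^ (L - 2) / (2 * (L * D)))
      ≤ K * ((Finset.Icc 1 x).filter fun n => f n = 1).card := by
  classical
  set R := (Finset.Icc 1 x).filter fun n => f n = 1 with hR
  set Bad := (Finset.Ico i₀ (L - 1)).filter fun i =>
    0 ≤ (∑ p ∈ primeWindow C i, f p) * ∑ m ∈ window C (L - 2 - i), f m with hBad
  have hBadmem : ∀ i ∈ Bad, i₀ ≤ i ∧ i + 2 ≤ L ∧
      0 ≤ (∑ p ∈ primeWindow C i, f p) * ∑ m ∈ window C (L - 2 - i), f m := by
    intro i hi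
    rw [hBad, Finset.mem_filter, Finset.mem_Ico] at hi
    exact ⟨hi.1.1, by omega, hi.2⟩
  set Zi : ℕ → Finset (ℕ × ℕ) := fun i =>
    (primeWindow C i ×ˢ window C (L - 2 - i)).filter fun z => f z.1 * f z.2 = 1 with hZi
  have hcard : ((Bad.sigma Zi).card : ℝ) ≤ K * R.card := by
    have := card_le_mul_of_prime_mul (Bad.sigma Zi) (fun z => z.2.1) (fun z => z.2.2) R (C ^ i₀) K
      (card_primeFactors_residue_le hC hx hK) ?_ ?_
    · exact_mod_cast this
    · rintro ⟨i, p, m⟩ hz ⟨i', p', m'⟩ hz' h1 h2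
      simp only [hZi, Finset.mem_sigma, Finset.mem_filter, Finset.mem_product,
        mem_primeWindow] at hz hz' h1 h2
      subst h1 h2
      obtain rfl := window_index_unique hC hz.2.1.1.1 hz'.2.1.1.1
      rfl
    · rintro ⟨i, p, m⟩ hz
      simp only [hZi, Finset.mem_sigma, Finset.mem_filter, Finset.mem_product,
        mem_primeWindow] at hz
      obtain ⟨hi, ⟨⟨hp, hpp⟩, hm⟩, hfm⟩ := hz
      obtain ⟨b1, b2, -⟩ := hBadmem i hi
      refine ⟨hpp, lt_of_mem_window_of_le hC hp b1, ?_⟩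
      rw [hR, Finset.mem_filter, Finset.mem_Icc, hf.map_mul _ _ hpp.pos (pos_of_mem_window hm)]
      exact ⟨⟨Nat.mul_pos hpp.pos (pos_of_mem_window hm),
        (mul_mem_window_bound hC hp hm (by omega)).trans hL⟩, hfm⟩
  refine le_trans ?_ hcard
  rw [Finset.card_sigma, ← nsmul_eq_mul, Nat.cast_sum]
  refine Finset.card_nsmul_le_sum _ _ _ fun i hi => ?_
  obtain ⟨b1, b2, b3⟩ := hBadmem i hi
  have hc := two_mul_card_filter_mul_eq_one (primeWindow C i) (window C (L - 2 - i)) f f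
    (fun p hp => hf.eq_one_or p (mem_primeWindow.1 hp).2.pos)
    (fun m hm => hf.eq_one_or m (pos_of_mem_window hm))
  have hc' : ((primeWindow C i).card * (window C (L - 2 - i)).card : ℝ) ≤ 2 * (Zi i).card := by
    have : ((primeWindow C i).card * (window C (L - 2 - i)).card : ℤ) ≤ 2 * (Zi i).card := by
      rw [hZi]; simp only; linarith
    exact_mod_cast this
  have h1 := pow_div_le_card_primeWindow hD0 hD (by omega : i + 1 ≤ L)
  have h2 : (C : ℝ) ^ (L - 2 - i) ≤ (window C (L - 2 - i)).card := by
    exact_mod_cast pow_le_card_window hC _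
  have h3 := mul_le_mul h1 h2 (by positivity) (by positivity)
  have h4 : (C : ℝ) ^ i / (L * D) * (C : ℝ) ^ (L - 2 - i) = (C : ℝ) ^ (L - 2) / (L * D) := by
    rw [div_mul_eq_mul_div, ← pow_add]; congr 2; omega
  have h5 : (C : ℝ) ^ (L - 2) / (2 * (L * D)) = (C : ℝ) ^ (L - 2) / (L * D) / 2 := by
    rw [div_div, mul_comm 2]
  rw [h5]
  linarith

theorem card_double_mul_le (hf : IsSignCharacter f) (hC : 2 ≤ C) (hL : C ^ L ≤ x)
    (hx : x < C ^ (L + 1)) (hK : L + 1 ≤ K * i₀) {D : ℝ} (hD0 : 0 < D)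
    (hD : ∀ i : ℕ, (C : ℝ) ^ i / ((i + 1) * D) ≤ (primeWindow C i).card) :
    (((Finset.Ico i₀ L ×ˢ Finset.Ico i₀ L).filter fun z =>
        z.1 + z.2 + 3 ≤ L ∧ 0 ≤ (∑ p ∈ primeWindow C z.1, f p) *
          ((∑ q ∈ primeWindow C z.2, f q) * ∑ m ∈ window C (L - 3 - z.1 - z.2), f m)).card : ℝ)
      * ((C : ℝ) ^ (L - 3) / (2 * (L * D) ^ 2))
      ≤ K * K * ((Finset.Icc 1 x).filter fun n => f n = 1).card := by
  classical
  set R := (Finset.Icc 1 x).filter fun n => f n = 1 with hR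
  set Bad := (Finset.Ico i₀ L ×ˢ Finset.Ico i₀ L).filter fun z =>
        z.1 + z.2 + 3 ≤ L ∧ 0 ≤ (∑ p ∈ primeWindow C z.1, f p) *
          ((∑ q ∈ primeWindow C z.2, f q) * ∑ m ∈ window C (L - 3 - z.1 - z.2), f m) with hBad
  have hBadmem : ∀ z ∈ Bad, i₀ ≤ z.1 ∧ i₀ ≤ z.2 ∧ z.1 + z.2 + 3 ≤ L ∧
      0 ≤ (∑ p ∈ primeWindow C z.1, f p) *
          ((∑ q ∈ primeWindow C z.2, f q) * ∑ m ∈ window C (L - 3 - z.1 - z.2), f m) := by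
    intro z hz
    rw [hBad, Finset.mem_filter, Finset.mem_product, Finset.mem_Ico, Finset.mem_Ico] at hz
    exact ⟨hz.1.1.1, hz.1.2.1, hz.2.1, hz.2.2⟩
  set Zi : ℕ × ℕ → Finset (ℕ × ℕ × ℕ) := fun ij =>
    (primeWindow C ij.1 ×ˢ (primeWindow C ij.2 ×ˢ window C (L - 3 - ij.1 - ij.2))).filter
      fun z => f z.1 * (f z.2.1 * f z.2.2) = 1 with hZi
  have hcard : ((Bad.sigma Zi).card : ℝ) ≤ K * K * R.card := by
    have := card_le_mul_of_prime_mul_prime_mul (Bad.sigma Zi) (fun z => z.2.1) (fun z => z.2.2.1)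
      (fun z => z.2.2.2) R (C ^ i₀) K (card_primeFactors_residue_le hC hx hK) ?_ ?_
    · exact_mod_cast this
    · rintro ⟨⟨i, j⟩, p, q, m⟩ hz ⟨⟨i', j'⟩, p', q', m'⟩ hz' h1 h2 h3
      simp only [hZi, Finset.mem_sigma, Finset.mem_filter, Finset.mem_product,
        mem_primeWindow] at hz hz' h1 h2 h3
      subst h1 h2 h3
      obtain rfl := window_index_unique hC hz.2.1.1.1 hz'.2.1.1.1
      obtain rfl := window_index_unique hC hz.2.1.2.1.1 hz'.2.1.2.1.1
      rfl
    · rintro ⟨⟨i, j⟩, p, q, m⟩ hz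
      simp only [hZi, Finset.mem_sigma, Finset.mem_filter, Finset.mem_product,
        mem_primeWindow] at hz
      obtain ⟨hi, ⟨⟨hp, hpp⟩, ⟨hq, hqp⟩, hm⟩, hfm⟩ := hz
      obtain ⟨b1, b2, b3, -⟩ := hBadmem (i, j) hi
      simp only at b1 b2 b3
      refine ⟨hpp, lt_of_mem_window_of_le hC hp b1, hqp, lt_of_mem_window_of_le hC hq b2, ?_⟩
      have hm0 := pos_of_mem_window hm
      have hqm := Nat.mul_pos hqp.pos hm0
      rw [hR, Finset.mem_filter, Finset.mem_Icc, hf.map_mul _ _ hpp.pos hqm,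
        hf.map_mul _ _ hqp.pos hm0]
      refine ⟨⟨Nat.mul_pos hpp.pos hqm, le_trans ?_ hL⟩, hfm⟩
      rw [mem_window] at hp hq hm
      calc p * (q * m) ≤ C ^ (i + 1) * (C ^ (j + 1) * C ^ (L - 3 - i - j + 1)) :=
            Nat.mul_le_mul hp.2 (Nat.mul_le_mul hq.2 hm.2)
        _ = C ^ L := by rw [← pow_add, ← pow_add]; congr 1; omega
  refine le_trans ?_ hcard
  rw [Finset.card_sigma, ← nsmul_eq_mul, Nat.cast_sum]
  refine Finset.card_nsmul_le_sum _ _ _ fun z hz => ?_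
  obtain ⟨i, j⟩ := z
  obtain ⟨b1, b2, b3, b4⟩ := hBadmem (i, j) hz
  simp only at b1 b2 b3 b4
  have hc := two_mul_card_filter_mul_eq_one (primeWindow C i)
    (primeWindow C j ×ˢ window C (L - 3 - i - j)) f (fun z => f z.1 * f z.2)
    (fun p hp => hf.eq_one_or p (mem_primeWindow.1 hp).2.pos)
    (fun z hz => by
      rw [Finset.mem_product] at hz
      rcases hf.eq_one_or z.1 (mem_primeWindow.1 hz.1).2.pos with h | h <;>
        rcases hf.eq_one_or z.2 (pos_of_mem_window hz.2) with h' | h' <;> simp [h, h'])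
  have hprod : ∑ z ∈ primeWindow C j ×ˢ window C (L - 3 - i - j), f z.1 * f z.2
      = (∑ q ∈ primeWindow C j, f q) * ∑ m ∈ window C (L - 3 - i - j), f m := by
    rw [Finset.sum_mul_sum, ← Finset.sum_product']
  rw [hprod, Finset.card_product] at hc
  push_cast at hc
  have hc' : ((primeWindow C i).card * ((primeWindow C j).card * (window C (L - 3 - i - j)).card)
      : ℝ) ≤ 2 * (Zi (i, j)).card := by
    have : ((primeWindow C i).card * ((primeWindow C j).card * (window C (L - 3 - i - j)).card)
      : ℤ) ≤ 2 * (Zi (i, j)).card := by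
      rw [hZi]; simp only; linarith
    exact_mod_cast this
  have h1 := pow_div_le_card_primeWindow hD0 hD (by omega : i + 1 ≤ L)
  have h1' := pow_div_le_card_primeWindow hD0 hD (by omega : j + 1 ≤ L)
  have h2 : (C : ℝ) ^ (L - 3 - i - j) ≤ (window C (L - 3 - i - j)).card := by
    exact_mod_cast pow_le_card_window hC _
  have h3 := mul_le_mul h1 (mul_le_mul h1' h2 (by positivity) (by positivity)) (by positivity)
    (by positivity)
  have h4 : (C : ℝ) ^ i / (L * D) * ((C : ℝ) ^ j / (L * D) * (C : ℝ) ^ (L - 3 - i - j))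
      = (C : ℝ) ^ (L - 3) / (L * D) ^ 2 := by
    have : (C : ℝ) ^ (L - 3) = (C : ℝ) ^ i * (C ^ j * (C : ℝ) ^ (L - 3 - i - j)) := by
      rw [← pow_add, ← pow_add]; congr 1; omega
    rw [this]
    ring
  have h5 : (C : ℝ) ^ (L - 3) / (2 * (L * D) ^ 2) = (C : ℝ) ^ (L - 3) / (L * D) ^ 2 / 2 := by
    rw [div_div, mul_comm 2]
  rw [h5]
  linarith

theorem sum_one_div_residue_mul_le (hf : IsSignCharacter f) (hC : 2 ≤ C) (hL : C ^ L ≤ x)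
    (hx : x < C ^ (L + 1)) (hK : L + 1 ≤ K * i₀) {D : ℝ} (hD0 : 0 < D)
    (hD : ∀ i : ℕ, (C : ℝ) ^ i / ((i + 1) * D) ≤ (primeWindow C i).card)
    (J : Finset ℕ) (φ : ℕ → ℕ) (hφ₀ : ∀ j ∈ J, i₀ ≤ φ j) (hφ₁ : ∀ j ∈ J, φ j + j + 2 ≤ L)
    (hφ₂ : ∀ j ∈ J, L ≤ φ j + j + 3) (hφ : ∀ j ∈ J, 0 ≤ ∑ p ∈ primeWindow C (φ j), f p) :
    (C : ℝ) ^ (L - 3) / (2 * (L * D))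
        * ∑ j ∈ J, ∑ m ∈ (window C j).filter (fun m => f m = 1), 1 / (m : ℝ)
      ≤ K * ((Finset.Icc 1 x).filter fun n => f n = 1).card := by
  classical
  set R := (Finset.Icc 1 x).filter fun n => f n = 1 with hR
  set Zj : ℕ → Finset (ℕ × ℕ) := fun j =>
    (primeWindow C (φ j)).filter (fun p => f p = 1) ×ˢ (window C j).filter (fun m => f m = 1)
    with hZj
  have hcard : ((J.sigma Zj).card : ℝ) ≤ K * R.card := by
    have := card_le_mul_of_prime_mul (J.sigma Zj) (fun z => z.2.1) (fun z => z.2.2) R (C ^ i₀) K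
      (card_primeFactors_residue_le hC hx hK) ?_ ?_
    · exact_mod_cast this
    · rintro ⟨j, p, m⟩ hz ⟨j', p', m'⟩ hz' h1 h2
      simp only [hZj, Finset.mem_sigma, Finset.mem_filter, Finset.mem_product,
        mem_primeWindow] at hz hz' h1 h2
      subst h1 h2
      obtain rfl := window_index_unique hC hz.2.2.1 hz'.2.2.1
      rfl
    · rintro ⟨j, p, m⟩ hz
      simp only [hZj, Finset.mem_sigma, Finset.mem_filter, Finset.mem_product,
        mem_primeWindow] at hz
      obtain ⟨hj, ⟨⟨hp, hpp⟩, hfp⟩, hm, hfm⟩ := hz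
      refine ⟨hpp, lt_of_mem_window_of_le hC hp (hφ₀ j hj), ?_⟩
      rw [hR, Finset.mem_filter, Finset.mem_Icc, hf.map_mul _ _ hpp.pos (pos_of_mem_window hm),
        hfp, hfm]
      exact ⟨⟨Nat.mul_pos hpp.pos (pos_of_mem_window hm),
        (mul_mem_window_bound hC hp hm (hφ₁ j hj)).trans hL⟩, rfl⟩
  refine le_trans ?_ hcard
  rw [Finset.card_sigma, Finset.mul_sum, Nat.cast_sum]
  refine Finset.sum_le_sum fun j hj => ?_
  have hC0 : (1 : ℝ) ≤ C := by exact_mod_cast (by omega : 1 ≤ C)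
  have h1 := pow_div_le_card_primeWindow hD0 hD
    (by have := hφ₁ j hj; omega : φ j + 1 ≤ L)
  have h2 : ((primeWindow C (φ j)).card : ℝ)
      ≤ 2 * ((primeWindow C (φ j)).filter fun p => f p = 1).card := by
    have h := two_mul_card_filter_mul_eq_one (primeWindow C (φ j)) {0} f (fun _ => 1)
      (fun p hp => hf.eq_one_or p (mem_primeWindow.1 hp).2.pos) (by simp)
    have e : (((primeWindow C (φ j)) ×ˢ ({0} : Finset ℕ)).filter fun z => f z.1 * 1 = 1).card
        = ((primeWindow C (φ j)).filter fun p => f p = 1).card := by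
      rw [Finset.card_filter, Finset.card_filter, Finset.sum_product]
      simp
    rw [e] at h
    have hpos := hφ j hj
    have : ((primeWindow C (φ j)).card : ℤ)
        ≤ 2 * ((primeWindow C (φ j)).filter fun p => f p = 1).card := by
      simp at h
      linarith
    exact_mod_cast this
  have h3 : ∑ m ∈ (window C j).filter (fun m => f m = 1), 1 / (m : ℝ)
      ≤ ((window C j).filter fun m => f m = 1).card * (1 / (C : ℝ) ^ j) := by
    rw [← nsmul_eq_mul]
    refine Finset.sum_le_card_nsmul _ _ _ fun m hm => ?_
    have := (mem_window.1 (Finset.mem_filter.1 hm).1).1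
    refine one_div_le_one_div_of_le (by positivity) ?_
    exact_mod_cast this.le
  have h4 : (C : ℝ) ^ (L - 3) * (1 / (C : ℝ) ^ j) ≤ (C : ℝ) ^ (φ j) := by
    rw [mul_one_div, div_le_iff₀ (by positivity), ← pow_add]
    exact pow_le_pow_right₀ hC0 (by have := hφ₂ j hj; omega)
  calc _ ≤ (C : ℝ) ^ (L - 3) / (2 * (L * D))
          * (((window C j).filter fun m => f m = 1).card * (1 / (C : ℝ) ^ j)) := by gcongr
    _ = ((C : ℝ) ^ (L - 3) * (1 / (C : ℝ) ^ j)) / (L * D) / 2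
          * ((window C j).filter fun m => f m = 1).card := by
        rw [div_div _ _ (2 : ℝ), mul_comm _ (2 : ℝ)]; ring
    _ ≤ (C : ℝ) ^ (φ j) / (L * D) / 2 * ((window C j).filter fun m => f m = 1).card := by gcongr
    _ ≤ ((primeWindow C (φ j)).filter fun p => f p = 1).card
          * ((window C j).filter fun m => f m = 1).card := by
        gcongr
        linarith
    _ = _ := by rw [hZj, Finset.card_product]; push_cast; rfl

end Residues

section Harmonic

variable {f : ℕ → ℤ}

theorem IsSignCharacter.map_one (hf : IsSignCharacter f) : f 1 = 1 := by
  have h := hf.map_mul 1 1 one_pos one_pos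
  rcases hf.eq_one_or 1 one_pos with h1 | h1
  · exact h1
  · rw [mul_one, h1] at h; norm_num at h

/-- A sign character as an arithmetic function (so with value `0` at `0`). -/
def signArithmetic (f : ℕ → ℤ) : ArithmeticFunction ℤ :=
  ⟨fun n => if n = 0 then 0 else f n, by simp⟩

theorem signArithmetic_apply {n : ℕ} (hn : n ≠ 0) : signArithmetic f n = f n := by
  simp [signArithmetic, hn]

theorem IsSignCharacter.isMultiplicative (hf : IsSignCharacter f) :
    (signArithmetic f).IsMultiplicative := by
  rw [ArithmeticFunction.IsMultiplicative.iff_ne_zero]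
  refine ⟨by rw [signArithmetic_apply one_ne_zero, hf.map_one], fun {m n} hm hn _ => ?_⟩
  rw [signArithmetic_apply hm, signArithmetic_apply hn, signArithmetic_apply (mul_ne_zero hm hn)]
  exact hf.map_mul m n (Nat.pos_of_ne_zero hm) (Nat.pos_of_ne_zero hn)

theorem IsSignCharacter.map_pow (hf : IsSignCharacter f) {q : ℕ} (hq : 0 < q) (k : ℕ) :
    f (q ^ k) = f q ^ k := by
  induction k with
  | zero => simp [hf.map_one]
  | succ k ih => rw [pow_succ, hf.map_mul _ _ (pow_pos hq k) hq, ih, pow_succ]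

theorem IsSignCharacter.sum_divisors_nonneg (hf : IsSignCharacter f) (n : ℕ) :
    0 ≤ (signArithmetic f * (ArithmeticFunction.zeta : ArithmeticFunction ℤ)) n := by
  rcases Nat.eq_zero_or_pos n with rfl | hn
  · simp
  rw [(hf.isMultiplicative.mul
    ArithmeticFunction.isMultiplicative_zeta.natCast).multiplicative_factorization _ hn.ne']
  refine Finset.prod_nonneg fun q hq => ?_
  have hqp := Nat.prime_of_mem_primeFactors hq
  beta_reduce
  rw [ArithmeticFunction.coe_mul_zeta_apply, Nat.sum_divisors_prime_pow hqp,
    Finset.sum_congr rfl fun i _ => by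
      rw [signArithmetic_apply (pow_ne_zero i hqp.ne_zero), hf.map_pow hqp.pos]]
  rcases hf.eq_one_or q hqp.pos with h | h <;> rw [h]
  · simp; positivity
  · rw [neg_one_geom_sum]; split_ifs <;> norm_num

theorem IsSignCharacter.neg_one_le_sum_div (hf : IsSignCharacter f) (y : ℕ) :
    -1 ≤ ∑ d ∈ Finset.Icc 1 y, (f d : ℝ) / d := by
  rcases Nat.eq_zero_or_pos y with rfl | hy
  · simp
  have hy0 : (0 : ℝ) < y := by exact_mod_cast hy
  have h1 : (0 : ℤ) ≤ ∑ d ∈ Finset.Icc 1 y, f d * (y / d : ℕ) := by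
    have := ArithmeticFunction.sum_Ioc_mul_zeta_eq_sum (signArithmetic f) y
    have h2 : Finset.Ioc 0 y = Finset.Icc 1 y := rfl
    rw [h2] at this
    rw [← Finset.sum_congr rfl fun d hd => by
      rw [← signArithmetic_apply (f := f) (by rw [Finset.mem_Icc] at hd; omega : d ≠ 0)]]
    rw [← this]
    exact Finset.sum_nonneg fun n _ => hf.sum_divisors_nonneg n
  have h3 : (0 : ℝ) ≤ ∑ d ∈ Finset.Icc 1 y, (f d : ℝ) * (y / d : ℕ) := by
    have := Int.cast_nonneg (R := ℝ) h1
    rw [Int.cast_sum] at this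
    simpa only [Int.cast_mul, Int.cast_natCast] using this
  have h4 : ∑ d ∈ Finset.Icc 1 y, (f d : ℝ) * (y / d : ℕ)
      ≤ ∑ d ∈ Finset.Icc 1 y, (y * ((f d : ℝ) / d) + 1) := by
    refine Finset.sum_le_sum fun d hd => ?_
    rw [Finset.mem_Icc] at hd
    have h5 : ((y / d : ℕ) : ℝ) ≤ y / d := Nat.cast_div_le
    have h6 : (y / d : ℝ) < (y / d : ℕ) + 1 := by
      have := Nat.lt_floor_add_one ((y : ℝ) / d)
      rwa [Nat.floor_div_natCast, Nat.floor_natCast] at this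
    have h7 : (y : ℝ) * ((f d : ℝ) / d) = f d * (y / d) := by ring
    rw [h7]
    rcases hf.eq_one_or d hd.1 with h | h <;> rw [h] <;> push_cast <;> linarith
  rw [Finset.sum_add_distrib, ← Finset.mul_sum] at h4
  simp only [Finset.sum_const, Nat.card_Icc, add_tsub_cancel_right, nsmul_eq_mul, mul_one] at h4
  by_contra! h8
  nlinarith

theorem IsSignCharacter.log_le_sum_residue (hf : IsSignCharacter f) (y : ℕ) :
    (Real.log (y + 1 : ℕ) - 1) / 2
      ≤ ∑ m ∈ (Finset.Icc 1 y).filter (fun m => f m = 1), 1 / (m : ℝ) := by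
  have h1 := hf.neg_one_le_sum_div y
  have h2 := log_add_one_le_harmonic y
  rw [harmonic_eq_sum_Icc] at h2
  push_cast at h2 ⊢
  have h3 : ∑ m ∈ (Finset.Icc 1 y).filter (fun m => f m = 1), 1 / (m : ℝ)
      = (∑ d ∈ Finset.Icc 1 y, (f d : ℝ) / d + ∑ d ∈ Finset.Icc 1 y, (d : ℝ)⁻¹) / 2 := by
    rw [Finset.sum_filter, ← Finset.sum_add_distrib, Finset.sum_div]
    refine Finset.sum_congr rfl fun d hd => ?_
    rw [Finset.mem_Icc] at hd
    rcases hf.eq_one_or d hd.1 with h | h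
    · simp [h]
    · simp [h]; ring
  rw [h3]
  linarith

end Harmonic

section ResidueDensity

variable {f : ℕ → ℤ}

theorem card_triple_nonpos_le (h g : ℕ → ℤ) {L t : ℕ} (ht : 1 ≤ t) (hL : 100 * t ≤ L) :
    ((Finset.Ico t L ×ˢ Finset.Ico t L).filter fun z =>
        z.1 + z.2 < 100 * t ∧ h (z.1 - 1) * h (z.2 - 1) * h (z.1 + z.2 - 1) ≤ 0).card
      ≤ ((Finset.Ico (t - 1) L ×ˢ Finset.Ico (t - 1) L).filter fun z => z.1 + z.2 + 3 ≤ L ∧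
          0 ≤ h z.1 * (h z.2 * g (L - 3 - z.1 - z.2))).card
        + L * ((Finset.Ico (t - 1) (L - 1)).filter fun i => 0 ≤ h i * g (L - 2 - i)).card := by
  classical
  set F := (Finset.Ico t L ×ˢ Finset.Ico t L).filter fun z =>
    z.1 + z.2 < 100 * t ∧ h (z.1 - 1) * h (z.2 - 1) * h (z.1 + z.2 - 1) ≤ 0 with hF
  set B₂ := (Finset.Ico (t - 1) L ×ˢ Finset.Ico (t - 1) L).filter fun z => z.1 + z.2 + 3 ≤ L ∧
          0 ≤ h z.1 * (h z.2 * g (L - 3 - z.1 - z.2)) with hB₂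
  set B₁ := (Finset.Ico (t - 1) (L - 1)).filter fun i => 0 ≤ h i * g (L - 2 - i) with hB₁
  have hFmem : ∀ z ∈ F, (t ≤ z.1 ∧ z.1 < L) ∧ (t ≤ z.2 ∧ z.2 < L) ∧ z.1 + z.2 < 100 * t ∧
      h (z.1 - 1) * h (z.2 - 1) * h (z.1 + z.2 - 1) ≤ 0 := by
    intro z hz
    simp only [hF, Finset.mem_filter, Finset.mem_product, Finset.mem_Ico] at hz
    tauto
  rw [← Finset.card_filter_add_card_filter_not (s := F) fun z => (z.1 - 1, z.2 - 1) ∈ B₂]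
  refine add_le_add ?_ ?_
  · refine Finset.card_le_card_of_injOn (fun z => (z.1 - 1, z.2 - 1))
      (fun z hz => (Finset.mem_filter.1 hz).2) ?_
    intro z hz z' hz' heq
    have b := hFmem z (Finset.mem_filter.1 hz).1
    have b' := hFmem z' (Finset.mem_filter.1 hz').1
    simp only [Prod.mk.injEq] at heq
    ext <;> omega
  · have hle : ((Finset.Ico 0 L) ×ˢ B₁).card = L * B₁.card := by simp
    rw [← hle]
    refine Finset.card_le_card_of_injOn (fun z => (z.1, z.1 + z.2 - 1)) ?_ ?_
    · intro z hz
      rw [Finset.mem_coe, Finset.mem_filter] at hz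
      obtain ⟨⟨b1, b2⟩, ⟨b3, b4⟩, b5, b6⟩ := hFmem z hz.1
      have hn := hz.2
      rw [hB₂, Finset.mem_filter, Finset.mem_product, Finset.mem_Ico, Finset.mem_Ico] at hn
      have h1 : ¬ (0 ≤ h (z.1 - 1) * (h (z.2 - 1) * g (L - 3 - (z.1 - 1) - (z.2 - 1)))) :=
        fun h' => hn ⟨⟨⟨by simp; omega, by simp; omega⟩, by simp; omega, by simp; omega⟩,
          by simp; omega, h'⟩
      rw [(by omega : L - 3 - (z.1 - 1) - (z.2 - 1) = L - 2 - (z.1 + z.2 - 1))] at h1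
      simp only [hB₁, Finset.coe_product, Set.mem_prod, Finset.mem_coe, Finset.mem_Ico,
        Finset.mem_filter]
      refine ⟨⟨by omega, b2⟩, ⟨by omega, by omega⟩, ?_⟩
      by_contra h2
      rw [not_le] at h1 h2
      generalize h (z.1 - 1) = x at *
      generalize h (z.2 - 1) = y at *
      generalize h (z.1 + z.2 - 1) = w at *
      generalize g (L - 2 - (z.1 + z.2 - 1)) = v at *
      have h3 := mul_pos_of_neg_of_neg h1 h2
      have h4 : x * (y * v) * (w * v) = (x * y * w) * (v * v) := by ring
      rw [h4] at h3
      nlinarith [mul_self_nonneg v]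
    · intro z hz z' hz' heq
      have b := hFmem z (Finset.mem_filter.1 hz).1
      have b' := hFmem z' (Finset.mem_filter.1 hz').1
      simp only [Prod.mk.injEq] at heq
      ext <;> omega

theorem card_nonpos_even_le (k : ℕ → ℤ) {L t : ℕ} (ht : 100 ≤ t) (hL : 100 * t ≤ L)
    (hL' : L < 100 * t + 100) :
    ((Finset.Ico (5 * t) (49 * t)).filter fun j => k (2 * ((L - 1 - j) / 2)) ≤ 0).card
      ≤ 2 * ((Finset.Ico (25 * t) (48 * t)).filter fun a => k (2 * a) ≤ 0).card := by
  classical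
  have hle : (((Finset.Ico (25 * t) (48 * t)).filter fun a => k (2 * a) ≤ 0)
      ×ˢ Finset.range 2).card
      = 2 * ((Finset.Ico (25 * t) (48 * t)).filter fun a => k (2 * a) ≤ 0).card := by
    simp [mul_comm]
  rw [← hle]
  refine Finset.card_le_card_of_injOn (fun j => ((L - 1 - j) / 2, (L - 1 - j) % 2)) ?_ ?_
  · intro j hj
    simp only [Finset.coe_filter, Set.mem_ofPred_eq, Finset.mem_Ico] at hj
    simp only [Finset.coe_product, Set.mem_prod, Finset.mem_coe, Finset.mem_Ico,
        Finset.mem_filter, Finset.mem_range]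
    refine ⟨⟨by omega, hj.2⟩, by omega⟩
  · intro j hj j' hj' heq
    simp only [Finset.coe_filter, Set.mem_ofPred_eq, Finset.mem_Ico] at hj hj'
    simp only [Prod.mk.injEq] at heq
    omega

theorem sum_Icc_pow_eq_add_sum_window {C : ℕ} (hC : 1 ≤ C) {a b : ℕ} (hab : a ≤ b)
    (P : ℕ → Prop) [DecidablePred P] (w : ℕ → ℝ) :
    ∑ m ∈ (Finset.Icc 1 (C ^ b)).filter P, w m = ∑ m ∈ (Finset.Icc 1 (C ^ a)).filter P, w m
      + ∑ j ∈ Finset.Ico a b, ∑ m ∈ (window C j).filter P, w m := by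
  induction b, hab using Nat.le_induction with
  | base => simp
  | succ b hab ih =>
    rw [Finset.sum_Ico_succ_top hab, ← add_assoc, ← ih]
    have hle : C ^ b ≤ C ^ (b + 1) := Nat.pow_le_pow_right hC (by omega)
    rw [← Finset.sum_union]
    · congr 1
      ext m
      simp only [Finset.mem_filter, Finset.mem_union, Finset.mem_Icc, mem_window]
      by_cases hP : P m <;> simp only [hP, and_true, and_false, or_false]
      omega
    · refine Finset.disjoint_filter_filter (Finset.disjoint_left.2 fun m hm hm' => ?_)
      rw [Finset.mem_Icc] at hm
      rw [mem_window] at hm'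
      omega

theorem sum_one_div_window_le {C : ℕ} (hC : 1 ≤ C) (j : ℕ) (P : ℕ → Prop) [DecidablePred P] :
    ∑ m ∈ (window C j).filter P, 1 / (m : ℝ) ≤ C := by
  have hC0 : (0 : ℝ) < C := by exact_mod_cast hC
  calc ∑ m ∈ (window C j).filter P, 1 / (m : ℝ) ≤ ∑ m ∈ window C j, 1 / (m : ℝ) :=
        Finset.sum_le_sum_of_subset_of_nonneg (Finset.filter_subset _ _)
          fun _ _ _ => by positivity
    _ ≤ (window C j).card * (1 / (C : ℝ) ^ j) := by
        rw [← nsmul_eq_mul]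
        refine Finset.sum_le_card_nsmul _ _ _ fun m hm => ?_
        have := (mem_window.1 hm).1
        refine one_div_le_one_div_of_le (by positivity) ?_
        exact_mod_cast this.le
    _ ≤ (C : ℝ) ^ (j + 1) * (1 / (C : ℝ) ^ j) := by
        gcongr
        exact_mod_cast card_window_le C j
    _ = C := by rw [pow_succ]; field_simp

end ResidueDensity

section ResidueDensity

variable {f : ℕ → ℤ}

theorem le_sum_Ico_sum_window_residue (hf : IsSignCharacter f) {C t : ℕ} (hC : 3 ≤ C)
    (ht : 100 ≤ t) :
    10 * (t * Real.log C)
      ≤ ∑ j ∈ Finset.Ico (5 * t) (49 * t),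
          ∑ m ∈ (window C j).filter (fun m => f m = 1), 1 / (m : ℝ) := by
  have hD1 : 1 ≤ Real.log C := by
    rw [Real.le_log_iff_exp_le (by positivity)]
    have : (3 : ℝ) ≤ C := by exact_mod_cast hC
    linarith [Real.exp_one_lt_three]
  have h1 := sum_Icc_pow_eq_add_sum_window (C := C) (by omega) (by omega : 5 * t ≤ 49 * t)
    (fun m => f m = 1) (fun m => 1 / (m : ℝ))
  have h2 := hf.log_le_sum_residue (C ^ (49 * t))
  have h3 : ∑ m ∈ (Finset.Icc 1 (C ^ (5 * t))).filter (fun m => f m = 1), 1 / (m : ℝ)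
      ≤ 1 + 5 * t * Real.log C := by
    have h := harmonic_le_one_add_log (C ^ (5 * t))
    rw [harmonic_eq_sum_Icc] at h
    push_cast at h
    rw [Real.log_pow] at h
    push_cast at h
    refine le_trans ?_ h
    simp only [one_div]
    exact Finset.sum_le_sum_of_subset_of_nonneg (Finset.filter_subset _ _)
          fun _ _ _ => by positivity
  have h4 : 49 * t * Real.log C ≤ Real.log ((C ^ (49 * t) + 1 : ℕ) : ℝ) := by
    have h : Real.log ((C : ℝ) ^ (49 * t)) = 49 * t * Real.log C := by
      rw [Real.log_pow]; push_cast; ring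
    rw [← h]
    refine Real.log_le_log (by positivity) ?_
    push_cast
    linarith
  have ht1 : (100 : ℝ) ≤ t := by exact_mod_cast ht
  have h5 : (100 : ℝ) ≤ t * Real.log C := by nlinarith
  linarith

set_option maxHeartbeats 1000000 in
theorem le_card_residue_of_window (hf : IsSignCharacter f) {C L x : ℕ} (hC : 3 ≤ C)
    (hD : ∀ i : ℕ, (C : ℝ) ^ i / ((i + 1) * Real.log C) ≤ (primeWindow C i).card)
    (hL : C ^ L ≤ x) (hx : x < C ^ (L + 1)) (hL0 : 10 ^ 4 ≤ L) :
    (C : ℝ) ^ (L - 3) / (10 ^ 13 * C * Real.log C)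
      ≤ ((Finset.Icc 1 x).filter fun n => f n = 1).card := by
  classical
  set D := Real.log C with hDdef
  set r : ℝ := (((Finset.Icc 1 x).filter fun n => f n = 1).card : ℝ) with hr
  have hC3 : (3 : ℝ) ≤ C := by exact_mod_cast hC
  have hD1 : 1 ≤ D := by
    rw [hDdef, Real.le_log_iff_exp_le (by positivity)]
    linarith [Real.exp_one_lt_three]
  have hD0 : 0 < D := by linarith
  by_contra! hlt
  set ρ : ℝ := 1 / (10 ^ 13 * C * D) with hρ
  set Y : ℝ := (C : ℝ) ^ (L - 3) with hY
  have hY0 : 0 < Y := by positivity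
  have hrρ : r ≤ ρ * Y := by rw [hρ]; rw [div_eq_mul_one_div] at hlt; linarith
  have hρ0 : 0 < ρ := by positivity
  obtain ⟨t, ht⟩ : ∃ t, t = L / 100 := ⟨_, rfl⟩
  have ht100 : 100 ≤ t := by omega
  have htL : 100 * t ≤ L := by omega
  have htL' : L < 100 * t + 100 := by omega
  have hK : L + 1 ≤ 200 * (t - 1) := by omega
  have hL0' : (10 ^ 4 : ℝ) ≤ L := by exact_mod_cast hL0
  set h : ℕ → ℤ := fun i => ∑ p ∈ primeWindow C i, f p with hh
  set g : ℕ → ℤ := fun i => ∑ m ∈ window C i, f m with hg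
  -- the exceptional sets
  obtain ⟨A₁, hA₁⟩ : ∃ A₁, A₁ =
    ((Finset.Ico (t - 1) (L - 1)).filter fun i => 0 ≤ h i * g (L - 2 - i)).card := ⟨_, rfl⟩
  obtain ⟨A₂, hA₂⟩ : ∃ A₂, A₂ = ((Finset.Ico (t - 1) L ×ˢ Finset.Ico (t - 1) L).filter fun z =>
    z.1 + z.2 + 3 ≤ L ∧ 0 ≤ h z.1 * (h z.2 * g (L - 3 - z.1 - z.2))).card := ⟨_, rfl⟩
  obtain ⟨B, hB⟩ : ∃ B, B = ((Finset.Ico (25 * t) (48 * t)).filter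
    fun a => h (2 * a - 1) ≤ 0).card := ⟨_, rfl⟩
  have hA₁le : (A₁ : ℝ) ≤ 400 * L * D * ρ := by
    have h1 := card_single_mul_le hf (by omega : 2 ≤ C) hL hx hK hD0 hD
    rw [← hr] at h1
    change ((Finset.card _ : ℕ) : ℝ) * _ ≤ _ at h1
    rw [← hA₁] at h1
    have h2 : Y ≤ (C : ℝ) ^ (L - 2) := pow_le_pow_right₀ (by linarith) (by omega)
    have h3 : (A₁ : ℝ) * (Y / (2 * (L * D))) ≤ 200 * (ρ * Y) := by
      refine le_trans ?_ (h1.trans ?_)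
      · gcongr
      · push_cast; gcongr
    have h4 : (A₁ : ℝ) * (Y / (2 * (L * D))) = (A₁ * Y) / (2 * (L * D)) := by ring
    rw [h4, div_le_iff₀ (by positivity)] at h3
    nlinarith
  have hA₂le : (A₂ : ℝ) ≤ 80000 * (L * D) ^ 2 * ρ := by
    have h1 := card_double_mul_le hf (by omega : 2 ≤ C) hL hx hK hD0 hD
    rw [← hr] at h1
    change ((Finset.card _ : ℕ) : ℝ) * _ ≤ _ at h1
    rw [← hA₂] at h1
    have h3 : (A₂ : ℝ) * (Y / (2 * (L * D) ^ 2)) ≤ 200 * 200 * (ρ * Y) := by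
      refine h1.trans ?_
      push_cast; gcongr
    have h4 : (A₂ : ℝ) * (Y / (2 * (L * D) ^ 2)) = (A₂ * Y) / (2 * (L * D) ^ 2) := by ring
    rw [h4, div_le_iff₀ (by positivity)] at h3
    nlinarith
  have hBle : (B : ℝ) * t ≤ 240 * (80400 * (L * D) ^ 2 * ρ) := by
    have h1 := card_nonpos_double_mul_le (fun s => h (s - 1)) t
      ((Finset.Ico t L ×ˢ Finset.Ico t L).filter fun z =>
        z.1 + z.2 < 100 * t ∧ h (z.1 - 1) * h (z.2 - 1) * h (z.1 + z.2 - 1) ≤ 0)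
      (fun s u hs hu hsu hk => by
        simp only [Finset.mem_filter, Finset.mem_product, Finset.mem_Ico]
        exact ⟨⟨⟨hs, by omega⟩, hu, by omega⟩, hsu, hk⟩)
    have h2 := card_triple_nonpos_le h g (by omega : 1 ≤ t) htL
    rw [← hA₁, ← hA₂] at h2
    change Finset.card _ * t ≤ _ at h1
    rw [← hB] at h1
    have h3 : B * t ≤ 240 * (A₂ + L * A₁) := h1.trans (Nat.mul_le_mul_left _ h2)
    have h4 : (B : ℝ) * t ≤ 240 * (A₂ + L * A₁) := by exact_mod_cast h3
    refine h4.trans ?_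
    have h5 : (L : ℝ) * A₁ ≤ L * (400 * L * D * ρ) := by gcongr
    have h6 : (L : ℝ) * (400 * L * D * ρ) ≤ 400 * (L * D) ^ 2 * ρ := by
      have h7 : (L : ℝ) * (400 * L * D * ρ) = 400 * (L ^ 2 * D * ρ) * 1 := by ring
      have h8 : 400 * (L * D) ^ 2 * ρ = 400 * (L ^ 2 * D * ρ) * D := by ring
      rw [h7, h8]
      gcongr
    linarith
  have hLt : (L : ℝ) ≤ 101 * t := by
    have : L ≤ 101 * t := by omega
    exact_mod_cast this
  have ht0 : (100 : ℝ) ≤ t := by exact_mod_cast ht100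
  have hBle' : 2 * (B : ℝ) * C ≤ 5 * (t * D) := by
    have h1 : (B : ℝ) * t ≤ 240 * (80400 * (101 * t * D) ^ 2 * ρ) := by
      refine hBle.trans ?_
      gcongr
    have h2 : 240 * (80400 * (101 * t * D) ^ 2 * ρ)
        = (240 * 80400 * 101 ^ 2 / 10 ^ 13 * t * D / C) * t := by
      rw [hρ]; field_simp
    rw [h2] at h1
    have h3 := le_of_mul_le_mul_right h1 (by linarith)
    rw [le_div_iff₀ (by linarith)] at h3
    have : 0 < t * D := by positivity
    nlinarith
  set J := (Finset.Ico (5 * t) (49 * t)).filter fun j => ¬ h (2 * ((L - 1 - j) / 2) - 1) ≤ 0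
    with hJ
  have hJmem : ∀ j ∈ J, (5 * t ≤ j ∧ j < 49 * t) ∧ 0 < h (2 * ((L - 1 - j) / 2) - 1) := by
    intro j hj
    simpa [hJ] using hj
  have hres := sum_one_div_residue_mul_le hf (by omega : 2 ≤ C) hL hx hK hD0 hD J
    (fun j => 2 * ((L - 1 - j) / 2) - 1)
    (fun j hj => by have := hJmem j hj; omega) (fun j hj => by have := hJmem j hj; omega)
    (fun j hj => by have := hJmem j hj; omega) (fun j hj => (hJmem j hj).2.le)
  set S : ℕ → ℝ := fun j => ∑ m ∈ (window C j).filter (fun m => f m = 1), 1 / (m : ℝ) with hS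
  have hall : 10 * (t * D) ≤ ∑ j ∈ Finset.Ico (5 * t) (49 * t), S j :=
    le_sum_Ico_sum_window_residue hf hC ht100
  have hsplit := Finset.sum_filter_add_sum_filter_not (Finset.Ico (5 * t) (49 * t))
    (fun j => h (2 * ((L - 1 - j) / 2) - 1) ≤ 0) S
  have hbad : ∑ j ∈ (Finset.Ico (5 * t) (49 * t)).filter
      (fun j => h (2 * ((L - 1 - j) / 2) - 1) ≤ 0), S j ≤ 2 * B * C := by
    have h1 := card_nonpos_even_le (fun s => h (s - 1)) ht100 htL htL'
    change Finset.card _ ≤ 2 * Finset.card _ at h1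
    rw [← hB] at h1
    have h1' : (((Finset.Ico (5 * t) (49 * t)).filter
      (fun j => h (2 * ((L - 1 - j) / 2) - 1) ≤ 0)).card : ℝ) ≤ 2 * B := by exact_mod_cast h1
    have h2 := Finset.sum_le_card_nsmul ((Finset.Ico (5 * t) (49 * t)).filter
      (fun j => h (2 * ((L - 1 - j) / 2) - 1) ≤ 0)) S C
      (fun j _ => sum_one_div_window_le (by omega) j _)
    rw [nsmul_eq_mul] at h2
    exact h2.trans (by gcongr)
  have hgood : 5 * (t * D) ≤ ∑ j ∈ J, S j := by rw [hJ]; linarith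
  have h1 : Y / (2 * (L * D)) * (5 * (t * D)) ≤ 200 * (ρ * Y) := by
    refine le_trans ?_ (hres.trans ?_)
    · gcongr
    · push_cast; gcongr
  have h2 : Y / (2 * (101 * t * D)) * (5 * (t * D)) ≤ 200 * (ρ * Y) := by
    refine le_trans ?_ h1
    gcongr
  have h3 : Y / (2 * (101 * t * D)) * (5 * (t * D)) = Y * (5 / 202) := by
    field_simp; norm_num
  rw [h3] at h2
  have h4 : ρ ≤ 1 / 10 ^ 13 := by
    rw [hρ]
    refine one_div_le_one_div_of_le (by positivity) ?_
    nlinarith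
  nlinarith

/-- A completely multiplicative `±1`-valued function takes the value `1` with positive density in
every initial interval, uniformly in the function. -/
theorem exists_le_card_residue : ∃ c : ℝ, 0 < c ∧ ∀ f : ℕ → ℤ, IsSignCharacter f →
    ∀ x : ℕ, c * x ≤ ((Finset.Icc 1 x).filter fun n => f n = 1).card := by
  obtain ⟨C, hC, hD⟩ := exists_base_card_primeWindow
  have hC3 : (3 : ℝ) ≤ C := by exact_mod_cast hC
  have hD1 : 1 ≤ Real.log C := by
    rw [Real.le_log_iff_exp_le (by positivity)]
    linarith [Real.exp_one_lt_three]
  set c₁ : ℝ := 1 / (C : ℝ) ^ (10 ^ 4) with hc₁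
  set c₂ : ℝ := 1 / (C ^ 4 * (10 ^ 13 * C * Real.log C)) with hc₂
  have hc₁0 : 0 < c₁ := by positivity
  have hc₂0 : 0 < c₂ := by positivity
  refine ⟨min c₁ c₂, by positivity, fun f hf x => ?_⟩
  rcases Nat.eq_zero_or_pos x with rfl | hx0
  · simp
  have hx0' : (0 : ℝ) < x := by exact_mod_cast hx0
  obtain ⟨L, hLdef⟩ : ∃ L, L = Nat.log C x := ⟨_, rfl⟩
  have hL : C ^ L ≤ x := hLdef ▸ Nat.pow_log_le_self C hx0.ne'
  have hx : x < C ^ (L + 1) := hLdef ▸ Nat.lt_pow_succ_log_self (by omega) x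
  have hxr : (x : ℝ) ≤ (C : ℝ) ^ (L + 1) := by exact_mod_cast hx.le
  by_cases hL0 : 10 ^ 4 ≤ L
  · refine le_trans ?_ (le_card_residue_of_window hf hC hD hL hx hL0)
    calc min c₁ c₂ * x ≤ c₂ * (C : ℝ) ^ (L + 1) := by
          gcongr
          exact min_le_right _ _
      _ = _ := by
          obtain ⟨l, rfl⟩ : ∃ l, L = l + 3 := ⟨L - 3, by omega⟩
          rw [hc₂, Nat.add_sub_cancel, (by ring : l + 3 + 1 = l + 4), pow_add]
          field_simp
  · have h1 : 1 ≤ ((Finset.Icc 1 x).filter fun n => f n = 1).card := by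
      refine Finset.card_pos.2 ⟨1, ?_⟩
      rw [Finset.mem_filter, Finset.mem_Icc]
      exact ⟨⟨le_rfl, hx0⟩, hf.map_one⟩
    have h1' : (1 : ℝ) ≤ ((Finset.Icc 1 x).filter fun n => f n = 1).card := by exact_mod_cast h1
    refine le_trans ?_ h1'
    calc min c₁ c₂ * x ≤ c₁ * (C : ℝ) ^ (10 ^ 4) := by
          gcongr
          · exact min_le_left _ _
          · exact hxr.trans (pow_le_pow_right₀ (by linarith) (by omega))
      _ = 1 := by rw [hc₁, one_div, inv_mul_cancel₀ (by positivity)]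

end ResidueDensity

section NonresidueDensity

variable {f : ℕ → ℤ}

theorem card_multiples_Icc (N d : ℕ) : ((Finset.Icc 1 N).filter fun n => d ∣ n).card = N / d :=
  Nat.Ioc_filter_dvd_card_eq_div N d

theorem card_common_multiples_le {q q' : ℕ} (hq : q.Prime) (hq' : q'.Prime) (N : ℕ) :
    (((Finset.Icc 1 N).filter fun n => q ∣ n ∧ q' ∣ n).card : ℝ)
      ≤ N * (1 / q * (1 / q')) + if q = q' then N * (1 / (q : ℝ)) else 0 := by
  split_ifs with h
  · subst h
    have h1 : ((Finset.Icc 1 N).filter fun n => q ∣ n ∧ q ∣ n).card = N / q := by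
      simp only [and_self, card_multiples_Icc]
    rw [h1]
    have h2 : ((N / q : ℕ) : ℝ) ≤ N / q := Nat.cast_div_le
    have h3 : (0 : ℝ) ≤ N * (1 / q * (1 / q)) := by positivity
    have h4 : (N : ℝ) * (1 / q) = N / q := by ring
    linarith
  · have h1 : ((Finset.Icc 1 N).filter fun n => q ∣ n ∧ q' ∣ n).card = N / (q * q') := by
      rw [← card_multiples_Icc]
      congr 1
      refine Finset.filter_congr fun n _ => ?_
      exact ⟨fun hn => ((Nat.coprime_primes hq hq').2 h).mul_dvd_of_dvd_of_dvd hn.1 hn.2,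
        fun hn => ⟨(dvd_mul_right _ _).trans hn, (dvd_mul_left _ _).trans hn⟩⟩
    rw [h1, add_zero]
    have h2 : ((N / (q * q') : ℕ) : ℝ) ≤ N / (q * q' : ℕ) := Nat.cast_div_le
    refine h2.trans (le_of_eq ?_)
    push_cast
    ring

theorem sum_sq_card_prime_divisors_le (T : Finset ℕ) (hT : ∀ q ∈ T, q.Prime) (N : ℕ) :
    ∑ n ∈ Finset.Icc 1 N, ((T.filter fun q => q ∣ n).card : ℝ) ^ 2
      ≤ N * ((∑ q ∈ T, 1 / (q : ℝ)) ^ 2 + ∑ q ∈ T, 1 / (q : ℝ)) := by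
  have h1 : ∑ n ∈ Finset.Icc 1 N, ((T.filter fun q => q ∣ n).card : ℝ) ^ 2
      = ∑ q ∈ T, ∑ q' ∈ T, (((Finset.Icc 1 N).filter fun n => q ∣ n ∧ q' ∣ n).card : ℝ) := by
    simp only [Finset.card_filter, Nat.cast_sum, sq, Finset.sum_mul_sum]
    rw [Finset.sum_comm]
    refine Finset.sum_congr rfl fun q _ => ?_
    rw [Finset.sum_comm]
    refine Finset.sum_congr rfl fun q' _ => Finset.sum_congr rfl fun n _ => ?_
    by_cases a : q ∣ n <;> by_cases b : q' ∣ n <;> simp [a, b]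
  rw [h1]
  calc _ ≤ ∑ q ∈ T, ∑ q' ∈ T,
        (N * (1 / q * (1 / q')) + if q = q' then N * (1 / (q : ℝ)) else 0) :=
        Finset.sum_le_sum fun q hq => Finset.sum_le_sum fun q' hq' =>
          card_common_multiples_le (hT q hq) (hT q' hq') N
    _ = _ := by
        simp only [Finset.sum_add_distrib, Finset.sum_ite_eq]
        rw [Finset.sum_congr rfl fun q hq => if_pos hq, ← Finset.mul_sum, mul_add, sq,
          Finset.sum_mul_sum]
        simp only [← Finset.mul_sum]

theorem sum_card_prime_divisors_ge (hf : IsSignCharacter f) {c : ℝ} (hc : 0 < c)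
    (hR : ∀ x : ℕ, c * x ≤ ((Finset.Icc 1 x).filter fun n => f n = 1).card)
    (T : Finset ℕ) (N : ℕ) (hT : ∀ q ∈ T, 0 < q ∧ q ≤ N ∧ f q = -1) :
    c / 2 * N * ∑ q ∈ T, 1 / (q : ℝ)
      ≤ ∑ n ∈ (Finset.Icc 1 N).filter (fun n => f n = -1),
          ((T.filter fun q => q ∣ n).card : ℝ) := by
  have h1 : ∑ n ∈ (Finset.Icc 1 N).filter (fun n => f n = -1),
      ((T.filter fun q => q ∣ n).card : ℝ)
      = ∑ q ∈ T, ((((Finset.Icc 1 N).filter fun n => f n = -1).filter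
          fun n => q ∣ n).card : ℝ) := by
    simp only [Finset.card_filter, Nat.cast_sum]
    rw [Finset.sum_comm]
  rw [h1, Finset.mul_sum]
  refine Finset.sum_le_sum fun q hq => ?_
  obtain ⟨hq0, hqN, hfq⟩ := hT q hq
  have h2 : ((Finset.Icc 1 (N / q)).filter fun n => f n = 1).card
      ≤ (((Finset.Icc 1 N).filter fun n => f n = -1).filter fun n => q ∣ n).card := by
    refine Finset.card_le_card_of_injOn (fun m => q * m) (fun m hm => ?_)
      fun m _ m' _ h => Nat.eq_of_mul_eq_mul_left hq0 h
    simp only [Finset.coe_filter, Set.mem_ofPred_eq, Finset.mem_filter, Finset.mem_Icc] at hm ⊢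
    refine ⟨⟨⟨Nat.mul_pos hq0 hm.1.1, ?_⟩, ?_⟩, dvd_mul_right _ _⟩
    · exact (Nat.mul_le_mul_left _ hm.1.2).trans (Nat.mul_div_le N q)
    · rw [hf.map_mul q m hq0 hm.1.1, hfq, hm.2]; rfl
  have h2' : (((Finset.Icc 1 (N / q)).filter fun n => f n = 1).card : ℝ)
      ≤ (((Finset.Icc 1 N).filter fun n => f n = -1).filter fun n => q ∣ n).card := by
    exact_mod_cast h2
  refine le_trans ?_ ((hR (N / q)).trans h2')
  have h3 : 1 ≤ N / q := (Nat.one_le_div_iff hq0).2 hqN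
  have h3' : (1 : ℝ) ≤ (N / q : ℕ) := by exact_mod_cast h3
  have h4 : (N : ℝ) / q < (N / q : ℕ) + 1 := by
    have := Nat.lt_floor_add_one ((N : ℝ) / q)
    rwa [Nat.floor_div_natCast, Nat.floor_natCast] at this
  have h5 : c / 2 * N * (1 / q) = c * (N / q / 2) := by ring
  rw [h5]
  gcongr
  linarith

theorem le_card_nonresidue (hf : IsSignCharacter f) {c κ : ℝ} (hc : 0 < c) (hκ : 0 < κ)
    (hR : ∀ x : ℕ, c * x ≤ ((Finset.Icc 1 x).filter fun n => f n = 1).card)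
    {N₀ N : ℕ} (hN : N₀ ≤ N)
    (hS : κ ≤ ∑ q ∈ (Finset.Icc 1 N₀).filter (fun q => q.Prime ∧ f q = -1), 1 / (q : ℝ)) :
    c ^ 2 * κ / (4 * (1 + κ)) * N
      ≤ ((Finset.Icc 1 N).filter fun n => f n = -1).card := by
  set T := (Finset.Icc 1 N₀).filter (fun q => q.Prime ∧ f q = -1) with hT
  set S := ∑ q ∈ T, 1 / (q : ℝ) with hSdef
  set W := (Finset.Icc 1 N).filter fun n => f n = -1 with hW
  have hTmem : ∀ q ∈ T, q ≤ N₀ ∧ q.Prime ∧ f q = -1 := by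
    intro q hq
    rw [hT, Finset.mem_filter, Finset.mem_Icc] at hq
    exact ⟨hq.1.2, hq.2⟩
  have h1 := sum_card_prime_divisors_ge hf hc hR T N
    (fun q hq => ⟨(hTmem q hq).2.1.pos, (hTmem q hq).1.trans hN, (hTmem q hq).2.2⟩)
  have h2 := sum_sq_card_prime_divisors_le T (fun q hq => (hTmem q hq).2.1) N
  have h3 : ∑ n ∈ W, ((T.filter fun q => q ∣ n).card : ℝ) ^ 2
      ≤ ∑ n ∈ Finset.Icc 1 N, ((T.filter fun q => q ∣ n).card : ℝ) ^ 2 :=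
    Finset.sum_le_sum_of_subset_of_nonneg (Finset.filter_subset _ _) fun _ _ _ => sq_nonneg _
  have h4 := sq_sum_le_card_mul_sum_sq (s := W) (f := fun n => ((T.filter fun q => q ∣ n).card : ℝ))
  rw [← hSdef] at h1 h2
  have hS0 : 0 < S := hκ.trans_le hS
  rcases Nat.eq_zero_or_pos N with h0 | hN0
  · simp [h0]
  have hN0' : (0 : ℝ) < N := by exact_mod_cast hN0
  have h5 : (c / 2 * N * S) ^ 2 ≤ W.card * (N * (S ^ 2 + S)) :=
    (pow_le_pow_left₀ (by positivity) h1 2).trans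
      (h4.trans (mul_le_mul_of_nonneg_left (h3.trans h2) (by positivity)))
  have h6 : (c / 2 * N * S) ^ 2 = (c ^ 2 * N * S / 4) * (N * S) := by ring
  have h7 : (W.card : ℝ) * (N * (S ^ 2 + S)) = (W.card * (1 + S)) * (N * S) := by ring
  rw [h6, h7] at h5
  have h8 := le_of_mul_le_mul_right h5 (by positivity)
  have h9 : c ^ 2 * N * S / 4 / (1 + S) ≤ W.card := by rwa [div_le_iff₀ (by positivity)]
  refine le_trans ?_ h9
  rw [div_mul_eq_mul_div, div_div, div_le_div_iff₀ (by positivity) (by positivity)]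
  have : 0 < c ^ 2 * N := by positivity
  nlinarith [mul_le_mul_of_nonneg_left hS this.le]

end NonresidueDensity

section LegendreSign

/-- The quadratic character modulo `p`, evaluated at the part of `n` prime to `p`. -/
def legendreSign (p : ℕ) [Fact p.Prime] (n : ℕ) : ℤ :=
  quadraticChar (ZMod p) ((n / p ^ n.factorization p : ℕ) : ZMod p)

variable {p : ℕ} [Fact p.Prime]

theorem legendreSign_of_not_dvd {n : ℕ} (h : ¬ p ∣ n) :
    legendreSign p n = quadraticChar (ZMod p) (n : ZMod p) := by
  rw [legendreSign, Nat.factorization_eq_zero_of_not_dvd h, pow_zero, Nat.div_one]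

theorem quadraticChar_natCast_eq_one_or {n : ℕ} (h : ¬ p ∣ n) :
    quadraticChar (ZMod p) (n : ZMod p) = 1 ∨ quadraticChar (ZMod p) (n : ZMod p) = -1 :=
  quadraticChar_dichotomy fun h0 => h ((ZMod.natCast_eq_zero_iff n p).1 h0)

theorem isSignCharacter_legendreSign : IsSignCharacter (legendreSign p) where
  map_mul m n _ _ := by
    rw [legendreSign, Nat.ordCompl_mul, Nat.cast_mul, map_mul]
    rfl
  eq_one_or n hn := quadraticChar_natCast_eq_one_or
    (Nat.not_dvd_ordCompl Fact.out hn.ne')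

theorem IsSignCharacter.exists_prime_dvd {f : ℕ → ℤ} (hf : IsSignCharacter f) {n : ℕ}
    (hn : 0 < n) (h : f n = -1) : ∃ q, q.Prime ∧ q ∣ n ∧ f q = -1 := by
  induction n using Nat.strong_induction_on with
  | _ n ih =>
    have h1 : n ≠ 1 := by
      rintro rfl
      rw [hf.map_one] at h
      norm_num at h
    obtain ⟨q, hq, m, rfl⟩ := Nat.exists_prime_and_dvd h1
    have hm : 0 < m := Nat.pos_of_mul_pos_left hn
    rcases hf.eq_one_or q hq.pos with hq1 | hq1
    · rw [hf.map_mul _ _ hq.pos hm, hq1, one_mul] at h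
      obtain ⟨r, hr, hrm, hfr⟩ := ih m (lt_mul_of_one_lt_left hm hq.one_lt) hm h
      exact ⟨r, hr, hrm.mul_left q, hfr⟩
    · exact ⟨q, hq, dvd_mul_right _ _, hq1⟩

/-- Vinogradov's trick: nonresidues up to `X` are accounted for by prime nonresidues. -/
theorem card_nonresidue_le {f : ℕ → ℤ} (hf : IsSignCharacter f) {Y X : ℕ} :
    (((Finset.Icc 1 X).filter fun n => f n = -1).card : ℝ)
      ≤ X * (∑ q ∈ (Finset.Icc 1 Y).filter (fun q => q.Prime ∧ f q = -1), 1 / (q : ℝ)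
        + ∑ q ∈ (Finset.Ioc Y X).filter Nat.Prime, 1 / (q : ℝ)) := by
  classical
  set T := (Finset.Icc 1 Y).filter (fun q => q.Prime ∧ f q = -1)
    ∪ (Finset.Ioc Y X).filter Nat.Prime with hT
  have h1 : (Finset.Icc 1 X).filter (fun n => f n = -1)
      ⊆ T.biUnion fun q => (Finset.Icc 1 X).filter fun n => q ∣ n := by
    intro n hn
    rw [Finset.mem_filter, Finset.mem_Icc] at hn
    obtain ⟨q, hq, hqn, hfq⟩ := hf.exists_prime_dvd hn.1.1 hn.2
    have hqle := Nat.le_of_dvd hn.1.1 hqn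
    simp only [hT, Finset.mem_biUnion, Finset.mem_union, Finset.mem_filter, Finset.mem_Icc,
      Finset.mem_Ioc]
    refine ⟨q, ?_, hn.1, hqn⟩
    rcases le_or_gt q Y with h | h
    · exact Or.inl ⟨⟨hq.pos, h⟩, hq, hfq⟩
    · exact Or.inr ⟨⟨h, hqle.trans hn.1.2⟩, hq⟩
  have h2 := (Finset.card_le_card h1).trans Finset.card_biUnion_le
  have h3 : (((Finset.Icc 1 X).filter fun n => f n = -1).card : ℝ)
      ≤ ∑ q ∈ T, (((Finset.Icc 1 X).filter fun n => q ∣ n).card : ℝ) := by exact_mod_cast h2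
  refine h3.trans ?_
  calc _ ≤ ∑ q ∈ T, X * (1 / (q : ℝ)) := by
        refine Finset.sum_le_sum fun q _ => ?_
        rw [card_multiples_Icc, mul_one_div]
        exact Nat.cast_div_le
    _ = _ := by
        rw [← Finset.mul_sum, hT, Finset.sum_union]
        refine Finset.disjoint_left.2 fun q hq hq' => ?_
        simp only [Finset.mem_filter, Finset.mem_Icc, Finset.mem_Ioc] at hq hq'
        omega

theorem sum_sign_eq {f : ℕ → ℤ} (hf : IsSignCharacter f) (X : ℕ) :
    ∑ n ∈ Finset.Icc 1 X, (f n : ℝ)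
      = X - 2 * ((Finset.Icc 1 X).filter fun n => f n = -1).card := by
  have h : ∀ n ∈ Finset.Icc 1 X, (f n : ℝ) = 1 - 2 * if f n = -1 then 1 else 0 := by
    intro n hn
    rw [Finset.mem_Icc] at hn
    rcases hf.eq_one_or n hn.1 with h | h <;> rw [h] <;> norm_num
  rw [Finset.sum_congr rfl h, Finset.sum_sub_distrib, ← Finset.mul_sum, Finset.card_filter]
  simp

open Filter in
theorem eventually_rpow_le_floor_rpow {α β : ℝ} (hα : 0 ≤ α) (hαβ : α < β) :
    ∀ᶠ p : ℕ in atTop, (p : ℝ) ^ α ≤ ⌊(p : ℝ) ^ β⌋₊ := by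
  have h1 := (tendsto_rpow_atTop (sub_pos.2 hαβ)).comp
    (tendsto_natCast_atTop_atTop (R := ℝ))
  filter_upwards [h1.eventually_ge_atTop 2, eventually_ge_atTop 1] with p hp hp1
  have hp1' : (1 : ℝ) ≤ p := by exact_mod_cast hp1
  have h2 : (p : ℝ) ^ β = (p : ℝ) ^ (β - α) * (p : ℝ) ^ α := by
    rw [← Real.rpow_add (by linarith)]; congr 1; ring
  have h3 : 1 ≤ (p : ℝ) ^ α := Real.one_le_rpow hp1' hα
  have h4 : 2 * (p : ℝ) ^ α ≤ (p : ℝ) ^ β := by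
    rw [h2]; gcongr; exact hp
  have := Nat.lt_floor_add_one ((p : ℝ) ^ β)
  linarith

end LegendreSign

section Assembly

open Filter in
theorem exists_le_sum_prime_nonresidue {ε : ℝ} (hε : 0 < ε) (hε' : ε ≤ 1 / 8) :
    ∃ κ : ℝ, 0 < κ ∧ ∀ᶠ p : ℕ in atTop, ∀ _ : Fact p.Prime,
      κ ≤ ∑ q ∈ (Finset.Icc 1 ⌊(p : ℝ) ^ (1 / (4 * Real.sqrt (Real.exp 1)) + ε)⌋₊).filter
        (fun q => q.Prime ∧ legendreSign p q = -1), 1 / (q : ℝ) := by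
  set E := Real.sqrt (Real.exp 1) with hE
  have hElog : Real.log E = 1 / 2 := by
    rw [hE, Real.log_sqrt (Real.exp_pos 1).le, Real.log_exp]
  have hE1 : 1 < E := by
    rw [hE, Real.lt_sqrt (by norm_num)]
    simp
  have hE0 : 0 < E := by linarith
  set θ := 1 / (4 * E) + ε with hθ
  set a := 1 / 4 + ε with ha
  set b := (a / E + θ) / 2 with hb
  have haE : a / E < θ := by
    have h1 : a / E = 1 / (4 * E) + ε / E := by rw [ha, add_div, div_div]
    have h2 : ε / E < ε := by rw [div_lt_iff₀ hE0]; nlinarith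
    linarith
  have ha0 : 0 < a := by positivity
  have hb0 : 0 < b := by positivity
  have hbθ : b < θ := by rw [hb]; linarith
  have hθa : θ < a := by
    have : 1 / (4 * E) < 1 / 4 := by
      apply one_div_lt_one_div_of_lt <;> linarith
    linarith
  have hlog : Real.log (a / b) < 1 / 2 := by
    rw [← hElog]
    refine Real.log_lt_log (by positivity) ?_
    rw [div_lt_iff₀ hb0]
    have h3 : a / E < b := by rw [hb]; linarith
    rw [div_lt_iff₀ hE0] at h3
    linarith
  have hlog0 : 0 < Real.log (a / b) := Real.log_pos (by rw [one_lt_div hb0]; linarith)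
  obtain ⟨κ, hκ⟩ : ∃ κ, κ = (1 / 2 - Real.log (a / b)) / 4 := ⟨_, rfl⟩
  have hκ0 : 0 < κ := by rw [hκ]; linarith
  obtain ⟨C, hC, hmertens⟩ := exists_sum_one_div_prime_le
  obtain ⟨p₁, hburgess⟩ := abs_sum_quadraticChar_Icc_le κ (ε / 2) hκ0 (by linarith)
    (by linarith) (by linarith)
  have hlogp := Real.tendsto_log_atTop.comp (tendsto_natCast_atTop_atTop (R := ℝ))
  have hpow := (tendsto_rpow_atTop hb0).comp (tendsto_natCast_atTop_atTop (R := ℝ))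
  refine ⟨κ, hκ0, ?_⟩
  filter_upwards [eventually_ge_atTop p₁, eventually_ge_atTop 2,
    eventually_rpow_le_floor_rpow hb0.le hbθ,
    eventually_rpow_le_floor_rpow (by linarith : 0 ≤ 1 / 4 + ε / 2)
      (by rw [ha]; linarith : 1 / 4 + ε / 2 < a),
    hlogp.eventually_ge_atTop (C / (b * κ)), hpow.eventually_ge_atTop 2]
    with p hp₁ hp2 hY hX hlp hp2b hpf
  have hp0 : (0 : ℝ) < p := by positivity
  have hp1 : (1 : ℝ) < p := by exact_mod_cast hp2
  have hlp0 : 0 < Real.log p := Real.log_pos hp1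
  obtain ⟨Y, hYdef⟩ : ∃ Y, Y = ⌊(p : ℝ) ^ θ⌋₊ := ⟨_, rfl⟩
  obtain ⟨X, hXdef⟩ : ∃ X, X = ⌊(p : ℝ) ^ a⌋₊ := ⟨_, rfl⟩
  rw [← hYdef] at hY ⊢
  rw [← hXdef] at hX
  have hXle : (X : ℝ) ≤ (p : ℝ) ^ a := hXdef ▸ Nat.floor_le (by positivity)
  have hYX : Y ≤ X := by
    rw [hYdef, hXdef]
    exact Nat.floor_le_floor (Real.rpow_le_rpow_of_exponent_le hp1.le hθa.le)
  have hY2 : (2 : ℝ) ≤ Y := le_trans hp2b hY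
  have hY2' : 2 ≤ Y := by exact_mod_cast hY2
  have hX0 : (0 : ℝ) < X := by
    have : (Y : ℝ) ≤ X := by exact_mod_cast hYX
    linarith
  have hXp : X < p := by
    have : (X : ℝ) < (p : ℝ) ^ (1 : ℝ) :=
      hXle.trans_lt (Real.rpow_lt_rpow_of_exponent_lt hp1 (by linarith))
    rw [Real.rpow_one] at this
    exact_mod_cast this
  have hb1 := hburgess p hp₁ hpf X hX
    (hXle.trans (Real.rpow_le_rpow_of_exponent_le hp1.le (by linarith)))
  have hchar : ∑ n ∈ Finset.Icc 1 X, (quadraticChar (ZMod p) n : ℝ)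
      = ∑ n ∈ Finset.Icc 1 X, (legendreSign p n : ℝ) := by
    refine Finset.sum_congr rfl fun n hn => ?_
    rw [Finset.mem_Icc] at hn
    rw [legendreSign_of_not_dvd fun h => by have := Nat.le_of_dvd (by omega) h; omega]
  rw [hchar, sum_sign_eq isSignCharacter_legendreSign] at hb1
  have hQ := card_nonresidue_le (isSignCharacter_legendreSign (p := p)) (Y := Y) (X := X)
  have hm := hmertens Y X hY2' hYX
  set S := ∑ q ∈ (Finset.Icc 1 Y).filter
    (fun q => q.Prime ∧ legendreSign p q = -1), 1 / (q : ℝ) with hS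
  have hlogY : b * Real.log p ≤ Real.log Y := by
    rw [← Real.log_rpow hp0]
    exact Real.log_le_log (by positivity) hY
  have hlogX : Real.log X ≤ a * Real.log p := by
    rw [← Real.log_rpow hp0]
    exact Real.log_le_log hX0 hXle
  have hblp : 0 < b * Real.log p := by positivity
  have hlogX0 : 0 < Real.log X := Real.log_pos (by
    have : (Y : ℝ) ≤ X := by exact_mod_cast hYX
    linarith)
  have h1 : Real.log (Real.log X / Real.log Y) ≤ Real.log (a / b) := by
    refine Real.log_le_log (div_pos hlogX0 (by linarith)) ?_
    calc Real.log X / Real.log Y ≤ a * Real.log p / (b * Real.log p) := by gcongr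
      _ = a / b := by field_simp
  have h2 : C / Real.log Y ≤ κ := by
    rw [div_le_iff₀ (by linarith)]
    have h3 : C / (b * κ) ≤ Real.log p := hlp
    rw [div_le_iff₀ (by positivity)] at h3
    nlinarith
  have h4 : ∑ q ∈ (Finset.Ioc Y X).filter Nat.Prime, 1 / (q : ℝ) ≤ 1 / 2 - 3 * κ := by
    linarith
  have h5 := (abs_le.1 hb1).2
  have h6 : (X : ℝ) * (S + ∑ q ∈ (Finset.Ioc Y X).filter Nat.Prime, 1 / (q : ℝ))
      ≤ X * (S + (1 / 2 - 3 * κ)) := by gcongr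
  have h7 : (X : ℝ) * ((1 - κ) / 2) ≤ X * (S + (1 / 2 - 3 * κ)) := by linarith
  have h8 := le_of_mul_le_mul_left h7 hX0
  linarith

end Assembly

section Assembly

theorem card_filter_quadraticChar_ge {p N : ℕ} [Fact p.Prime] {η : ℝ} {s : ℤ}
    (hp : 2 / η ≤ p) (hη : 0 < η)
    (h : η * N ≤ ((Finset.Icc 1 N).filter fun n => legendreSign p n = s).card) :
    η / 2 * N ≤ ((Finset.Icc 1 N).filter
      fun n : ℕ => quadraticChar (ZMod p) (n : ZMod p) = s).card := by
  have h1 : ((Finset.Icc 1 N).filter fun n => legendreSign p n = s).card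
      ≤ ((Finset.Icc 1 N).filter fun n : ℕ => quadraticChar (ZMod p) (n : ZMod p) = s).card
        + N / p := by
    rw [← card_multiples_Icc]
    refine (Finset.card_le_card fun n hn => ?_).trans (Finset.card_union_le _ _)
    rw [Finset.mem_filter] at hn
    rw [Finset.mem_union, Finset.mem_filter, Finset.mem_filter]
    by_cases hd : p ∣ n
    · exact Or.inr ⟨hn.1, hd⟩
    · exact Or.inl ⟨hn.1, legendreSign_of_not_dvd hd ▸ hn.2⟩
  have h1' : (((Finset.Icc 1 N).filter fun n => legendreSign p n = s).card : ℝ)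
      ≤ ((Finset.Icc 1 N).filter fun n : ℕ => quadraticChar (ZMod p) (n : ZMod p) = s).card
        + (N / p : ℕ) := by exact_mod_cast h1
  have hp0 : (0 : ℝ) < p := lt_of_lt_of_le (by positivity) hp
  have h2 : ((N / p : ℕ) : ℝ) ≤ η / 2 * N := by
    refine Nat.cast_div_le.trans ?_
    rw [div_le_iff₀ hp0]
    rw [div_le_iff₀ hη] at hp
    have : (0 : ℝ) ≤ N := Nat.cast_nonneg N
    nlinarith
  linarith

theorem exists_sign_card_ge {p : ℕ} [Fact p.Prime] (M : ℕ) :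
    ∃ s : ℤ, (s = 1 ∨ s = -1) ∧ (M : ℝ) / 4 ≤ ((Finset.Icc 1 M).filter
      fun n : ℕ => quadraticChar (ZMod p) (n : ZMod p) = s).card := by
  have h1 : (Finset.Icc 1 M).card
      ≤ ((Finset.Icc 1 M).filter fun n : ℕ => quadraticChar (ZMod p) (n : ZMod p) = 1).card
        + ((Finset.Icc 1 M).filter fun n : ℕ => quadraticChar (ZMod p) (n : ZMod p) = -1).card
        + M / p := by
    rw [← card_multiples_Icc]
    refine (Finset.card_le_card fun n hn => ?_).trans ((Finset.card_union_le _ _).trans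
      (Nat.add_le_add_right (Finset.card_union_le _ _) _))
    simp only [Finset.mem_union, Finset.mem_filter]
    by_cases hd : p ∣ n
    · exact Or.inr ⟨hn, hd⟩
    · rcases quadraticChar_natCast_eq_one_or hd with h | h
      · exact Or.inl (Or.inl ⟨hn, h⟩)
      · exact Or.inl (Or.inr ⟨hn, h⟩)
  have h2 : M / p ≤ M / 2 := Nat.div_le_div_left (Fact.out : p.Prime).two_le (by norm_num)
  rw [Nat.card_Icc, Nat.add_sub_cancel] at h1
  by_contra! h
  have h3 := h 1 (Or.inl rfl)
  have h4 := h (-1) (Or.inr rfl)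
  rw [lt_div_iff₀ (by norm_num)] at h3 h4
  generalize ((Finset.Icc 1 M).filter
    fun n : ℕ => quadraticChar (ZMod p) (n : ZMod p) = 1).card = a at h1 h3
  generalize ((Finset.Icc 1 M).filter
    fun n : ℕ => quadraticChar (ZMod p) (n : ZMod p) = -1).card = b at h1 h4
  norm_cast at h3 h4
  omega

theorem card_mul_card_le_card_legendreSym {p : ℕ} [Fact p.Prime] (N M : ℕ) (s s' : ℤ) :
    ((Finset.Icc 1 N).filter fun n : ℕ => quadraticChar (ZMod p) (n : ZMod p) = s).card
      * ((Finset.Icc 1 M).filter fun n : ℕ => quadraticChar (ZMod p) (n : ZMod p) = s').card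
      ≤ (((Finset.Icc 1 N) ×ˢ (Finset.Icc 1 M)).filter
        fun nm => legendreSym p ((nm.1 : ℤ) * (nm.2 : ℤ)) = s * s').card := by
  rw [← Finset.card_product]
  refine Finset.card_le_card fun z hz => ?_
  simp only [Finset.mem_product, Finset.mem_filter] at hz ⊢
  refine ⟨⟨hz.1.1, hz.2.1⟩, ?_⟩
  rw [legendreSym.mul, legendreSym, legendreSym, Int.cast_natCast, Int.cast_natCast, hz.1.2,
    hz.2.2]

end Assembly

theorem lower_bound_pairs_prescribed_legendre
    (σ : ℤ) (hσ : σ = 1 ∨ σ = -1) (ε : ℝ) (hε : 0 < ε) :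
    ∃ η : ℝ, 0 < η ∧ ∃ p₀ : ℕ, ∀ p : ℕ, p₀ ≤ p → ∀ hp : p.Prime,
      ∀ M : ℕ, 0 < M →
        η * (⌊(p : ℝ) ^ (1 / (4 * Real.sqrt (Real.exp 1)) + ε)⌋₊ : ℝ) * (M : ℝ) ≤
          ((((Finset.Icc 1 ⌊(p : ℝ) ^ (1 / (4 * Real.sqrt (Real.exp 1)) + ε)⌋₊) ×ˢ
              (Finset.Icc 1 M)).filter
            (fun nm => @legendreSym p ⟨hp⟩ ((nm.1 : ℤ) * (nm.2 : ℤ)) = σ)).card : ℝ) := by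
  obtain ⟨c, hc0, hres⟩ := exists_le_card_residue
  obtain ⟨κ, hκ0, hκ⟩ := exists_le_sum_prime_nonresidue (ε := min ε (1 / 8))
    (by positivity) (min_le_right _ _)
  set η₀ := min c (c ^ 2 * κ / (4 * (1 + κ))) with hη₀
  have hη₀0 : 0 < η₀ := by positivity
  obtain ⟨p₁, hp₁⟩ := Filter.eventually_atTop.1 hκ
  refine ⟨η₀ / 8, by positivity, max p₁ (max 1 ⌈2 / η₀⌉₊), fun p hpp hp M _ => ?_⟩
  have hfact : Fact p.Prime := ⟨hp⟩
  rw [max_le_iff, max_le_iff] at hpp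
  have hp2 : 2 / η₀ ≤ p := (Nat.le_ceil _).trans (by exact_mod_cast hpp.2.2)
  set N := ⌊(p : ℝ) ^ (1 / (4 * Real.sqrt (Real.exp 1)) + ε)⌋₊ with hN
  have hN₀ : ⌊(p : ℝ) ^ (1 / (4 * Real.sqrt (Real.exp 1)) + min ε (1 / 8))⌋₊ ≤ N := by
    refine Nat.floor_le_floor (Real.rpow_le_rpow_of_exponent_le ?_ ?_)
    · exact_mod_cast hpp.2.1
    · gcongr
      exact min_le_left _ _
  have hsign := isSignCharacter_legendreSign (p := p)
  have hdens : ∀ s : ℤ, (s = 1 ∨ s = -1) → η₀ / 2 * N ≤ ((Finset.Icc 1 N).filter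
      fun n : ℕ => quadraticChar (ZMod p) (n : ZMod p) = s).card := by
    intro s hs
    refine card_filter_quadraticChar_ge hp2 hη₀0 ?_
    rcases hs with rfl | rfl
    · exact le_trans (by gcongr; exact min_le_left _ _) (hres _ hsign N)
    · exact le_trans (by gcongr; exact min_le_right _ _)
        (le_card_nonresidue hsign hc0 hκ0 (hres _ hsign) hN₀ (hp₁ p hpp.1 hfact))
  obtain ⟨s, hs, hsM⟩ := exists_sign_card_ge (p := p) M
  have hσs : σ * s = 1 ∨ σ * s = -1 := by
    rcases hσ with rfl | rfl <;> rcases hs with rfl | rfl <;> norm_num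
  have hss : σ * s * s = σ := by rcases hs with rfl | rfl <;> ring
  have h := card_mul_card_le_card_legendreSym (p := p) N M (σ * s) s
  rw [hss] at h
  have h' : (((Finset.Icc 1 N).filter
      fun n : ℕ => quadraticChar (ZMod p) (n : ZMod p) = σ * s).card : ℝ)
      * ((Finset.Icc 1 M).filter fun n : ℕ => quadraticChar (ZMod p) (n : ZMod p) = s).card
      ≤ (((Finset.Icc 1 N) ×ˢ (Finset.Icc 1 M)).filter
        fun nm => legendreSym p ((nm.1 : ℤ) * (nm.2 : ℤ)) = σ).card := by exact_mod_cast h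
  refine le_trans ?_ h'
  calc η₀ / 8 * N * M = (η₀ / 2 * N) * (M / 4) := by ring
    _ ≤ _ := mul_le_mul (hdens _ hσs) hsM (by positivity) (by positivity)
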